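/- arXiv:1808.02543 — 6 statements merged into one kernel-verified Lean document; each statement's English description precedes it below -/
import Mathlib

section
/- Let f̄ : ℝ^d → ℝ be differentiable with L-Lipschitz gradient, let r : ℝ^d → ℝ ∪ {+∞} be proper, lower semicontinuous and convex, let α > 0, x ∈ ℝ^d, g ∈ ℝ^d, and set y = prox_{αr}(x − αg). Then for every z ∈ ℝ^d: f̄(y) + r(y) ≤ f̄(z) + r(z) + (y − z)ᵀ(∇f̄(x) − g) + (L/2 − 1/(2α))‖y − x‖² + (L/2 + 1/(2α))‖z − x‖² − (1/(2α))‖y − z‖². -/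
open Real
open scoped RealInnerProductSpace

noncomputable section

lemma aux_descent {E : Type*} [NormedAddCommGroup E] [InnerProductSpace ℝ E] [CompleteSpace E]
    (f : E → ℝ) (f' : E → E) (L : ℝ)
    (hgrad : ∀ u, HasFDerivAt f (innerSL ℝ (f' u)) u)
    (hlip : ∀ u v, ‖f' u - f' v‖ ≤ L * ‖u - v‖) (x v : E) :
    f v ≤ f x + ⟪f' x, v - x⟫ + L / 2 * ‖v - x‖ ^ 2 := by
  set h := v - x with hh
  have hd : ∀ t : ℝ, HasDerivAt
      (fun t : ℝ => f (x + t • h) - t * ⟪f' x, h⟫ - t ^ 2 * (L / 2 * ‖h‖ ^ 2))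
      (⟪f' (x + t • h), h⟫ - ⟪f' x, h⟫ - 2 * t * (L / 2 * ‖h‖ ^ 2)) t := by
    intro t
    have h1 : HasDerivAt (fun t : ℝ => x + t • h) h t := by
      simpa using ((hasDerivAt_id t).smul_const h).const_add x
    have h2 := (hgrad (x + t • h)).comp_hasDerivAt t h1
    have h3 := (hasDerivAt_id t).mul_const ⟪f' x, h⟫
    have h4 := (hasDerivAt_pow 2 t).mul_const (L / 2 * ‖h‖ ^ 2)
    have h5 := (h2.sub h3).sub h4
    refine h5.congr_deriv ?_
    simp
  have anti : AntitoneOn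
      (fun t : ℝ => f (x + t • h) - t * ⟪f' x, h⟫ - t ^ 2 * (L / 2 * ‖h‖ ^ 2)) (Set.Icc 0 1) := by
    refine antitoneOn_of_deriv_nonpos (convex_Icc 0 1)
      (fun t _ => (hd t).continuousAt.continuousWithinAt)
      (fun t _ => (hd t).differentiableAt.differentiableWithinAt) ?_
    intro t ht
    rw [interior_Icc] at ht
    rw [(hd t).deriv, ← inner_sub_left]
    have h1 := real_inner_le_norm (f' (x + t • h) - f' x) h
    have h2 := hlip (x + t • h) x
    rw [add_sub_cancel_left, norm_smul, Real.norm_of_nonneg ht.1.le] at h2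
    have h3 := mul_le_mul_of_nonneg_right h2 (norm_nonneg h)
    nlinarith
  have := anti (Set.left_mem_Icc.2 zero_le_one) (Set.right_mem_Icc.2 zero_le_one) zero_le_one
  simp only [one_smul, zero_smul, add_zero] at this
  rw [show x + h = v by simp [hh]] at this
  linarith

/-- The descent-type inequality for the proximal operator (Lemma 1 of the paper):
if `f̄` has `L`-Lipschitz gradient, `r : ℝ^d → ℝ ∪ {+∞}` is proper lsc convex, `α > 0` and
`y = prox_{αr}(x - αg)`, then for every `z`,
`f̄(y) + r(y) ≤ f̄(z) + r(z) + ⟪y - z, ∇f̄(x) - g⟫ + (L/2 - 1/(2α))‖y-x‖²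
  + (L/2 + 1/(2α))‖z-x‖² - (1/(2α))‖y-z‖²`. -/
theorem stmt0 {d : ℕ}
    (fbar : EuclideanSpace ℝ (Fin d) → ℝ)
    (f' : EuclideanSpace ℝ (Fin d) → EuclideanSpace ℝ (Fin d))
    (L : ℝ) (hL : 0 ≤ L)
    (hgrad : ∀ u, HasGradientAt fbar (f' u) u)
    (hlip : LipschitzWith L.toNNReal f')
    (r : EuclideanSpace ℝ (Fin d) → EReal)
    (hproper : ∃ u, r u ≠ ⊤) (hnobot : ∀ u, r u ≠ ⊥)
    (hlsc : LowerSemicontinuous r)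
    (hconv : ∀ u v : EuclideanSpace ℝ (Fin d), ∀ a b : ℝ, 0 ≤ a → 0 ≤ b → a + b = 1 →
      r (a • u + b • v) ≤ (a : EReal) * r u + (b : EReal) * r v)
    (α : ℝ) (hα : 0 < α)
    (x g y : EuclideanSpace ℝ (Fin d))
    -- `y = prox_{α r}(x - α g)`, i.e. `y` minimizes `r(·) + (1/(2α))‖· - (x - αg)‖²`
    (hy : ∀ z, r y + ((1 / (2 * α) * ‖y - (x - α • g)‖ ^ 2 : ℝ) : EReal) ≤
      r z + ((1 / (2 * α) * ‖z - (x - α • g)‖ ^ 2 : ℝ) : EReal)) :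
    ∀ z, (fbar y : EReal) + r y ≤ (fbar z : EReal) + r z +
      ((⟪y - z, f' x - g⟫ + (L / 2 - 1 / (2 * α)) * ‖y - x‖ ^ 2 +
        (L / 2 + 1 / (2 * α)) * ‖z - x‖ ^ 2 - 1 / (2 * α) * ‖y - z‖ ^ 2 : ℝ) : EReal) := by
  intro z
  have hyt : r y ≠ ⊤ := by
    intro hyt
    obtain ⟨u, hu⟩ := hproper
    have h := hy u
    rw [hyt, EReal.top_add_coe, top_le_iff] at h
    lift r u to ℝ using ⟨hu, hnobot u⟩ with ru
    exact absurd h (by rw [← EReal.coe_add]; exact EReal.coe_ne_top _)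
  by_cases hzt : r z = ⊤
  · rw [hzt, EReal.coe_add_top, EReal.top_add_coe]
    exact le_top
  obtain ⟨ry, hry⟩ : ∃ a : ℝ, r y = a := ⟨(r y).toReal, (EReal.coe_toReal hyt (hnobot y)).symm⟩
  obtain ⟨rz, hrz⟩ : ∃ a : ℝ, r z = a := ⟨(r z).toReal, (EReal.coe_toReal hzt (hnobot z)).symm⟩
  set w := x - α • g with hw
  set c := 1 / (2 * α) with hc
  have hcpos : 0 < c := by positivity
  have key : ∀ t : ℝ, 0 < t → t ≤ 1 →
      ry - rz - 2 * c * ⟪y - w, z - y⟫ ≤ t * (c * ‖z - y‖ ^ 2) := by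
    intro t ht ht1
    have h1 := hy ((1 - t) • y + t • z)
    have h2 := hconv y z (1 - t) t (by linarith) ht.le (by ring)
    have h3 := h1.trans (add_le_add_left h2 _)
    rw [hry, hrz] at h3
    norm_cast at h3
    have h4 : (1 - t) • y + t • z - w = (y - w) + t • (z - y) := by module
    rw [h4, norm_add_sq_real, inner_smul_right, norm_smul, Real.norm_of_nonneg ht.le] at h3
    have h5 : t * (ry - rz - 2 * c * ⟪y - w, z - y⟫) ≤ t * (t * (c * ‖z - y‖ ^ 2)) := by
      linarith
    exact le_of_mul_le_mul_left h5 ht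
  have hprox : ry - rz - 2 * c * ⟪y - w, z - y⟫ ≤ 0 := by
    by_contra! hpos
    set A := ry - rz - 2 * c * ⟪y - w, z - y⟫
    have hB : 0 ≤ c * ‖z - y‖ ^ 2 := by positivity
    set B := c * ‖z - y‖ ^ 2
    have h1 := key 1 one_pos le_rfl
    have hBp : 0 < B := by linarith
    have h2 := key (A / (2 * B)) (by positivity) (by rw [div_le_one (by positivity)]; linarith)
    have h3 : A / (2 * B) * B = A / 2 := by field_simp
    linarith
  have hl : ∀ u v, ‖f' u - f' v‖ ≤ L * ‖u - v‖ := by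
    intro u v
    have := hlip.norm_sub_le u v
    rwa [Real.coe_toNNReal L hL] at this
  have hF : ∀ u, HasFDerivAt fbar (innerSL ℝ (f' u)) u := fun u => (hgrad u).hasFDerivAt
  have d1 := aux_descent fbar f' L hF hl x y
  have d2 := aux_descent (fun u => - fbar u) (fun u => - f' u) L
    (fun u => by rw [map_neg]; exact (hF u).neg)
    (fun u v => by rw [← norm_neg]; simpa [sub_eq_add_neg, add_comm] using hl u v) x z
  rw [hry, hrz]
  norm_cast
  have e1 : 2 * c * ⟪y - w, z - y⟫ =
      c * (‖z - x‖ ^ 2 - ‖y - x‖ ^ 2 - ‖y - z‖ ^ 2) - ⟪y - z, g⟫ := by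
    have a1 : y - w = (y - x) + α • g := by rw [hw]; module
    have a2 : z - x = (y - x) + (z - y) := by abel
    have a3 : y - z = -(z - y) := by abel
    have a4 : 2 * c * α = 1 := by rw [hc]; field_simp
    rw [a1, a2, a3, norm_add_sq_real, norm_neg, inner_neg_left, inner_add_left,
      real_inner_smul_left, real_inner_comm g (z - y)]
    linear_combination ⟪g, z - y⟫ * a4
  have e2 : ⟪f' x, y - x⟫ - ⟪f' x, z - x⟫ = ⟪y - z, f' x⟫ := by
    rw [← inner_sub_right, real_inner_comm]
    congr 1
    abel
  simp only [inner_neg_left] at d2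
  rw [inner_sub_right]
  linarith

end
end

section
/- Fix a block index i ∈ {1,…,n}, a point x = (x_1,…,x_n) in the product of the effective domains, a noise vector w ∈ ℝ^{d_i}, and a steplength α_i > 0. Define x̄_i = prox_{α_i r_i}( x_i − α_i ∇_{x_i} f̄(x) ), and define x⁺ by x⁺_i = prox_{α_i r_i}( x_i − α_i( ∇_{x_i} f̄(x) + w ) ) and x⁺_j = x_j for j ≠ i. Then F(x⁺) ≤ F(x) + (L_i/2 − 1/(2α_i))‖x⁺_i − x_i‖² + (α_i/2)‖w‖² + (L_i − 1/(2α_i))‖x̄_i − x_i‖². -/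
open Real Finset
open scoped RealInnerProductSpace

noncomputable section

/-- `y` is a proximal point of `u` for the function `r` (understood as extended by `+∞`
outside its compact effective domain `D`) with parameter `α`:
`y ∈ argmin_{z ∈ D} ( r z + (1/(2α))‖z - u‖² )`. -/
def IsProxPt {E : Type*} [NormedAddCommGroup E]
    (r : E → ℝ) (D : Set E) (α : ℝ) (u y : E) : Prop :=
  y ∈ D ∧ ∀ z ∈ D, r y + 1 / (2 * α) * ‖y - u‖ ^ 2 ≤ r z + 1 / (2 * α) * ‖z - u‖ ^ 2

theorem aux_limit (A B K : ℝ) (h : ∀ s : ℝ, 0 < s → s ≤ 1 → A ≤ B + s * K) : A ≤ B := by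
  have ht : Filter.Tendsto (fun s : ℝ => B + s * K) (nhdsWithin 0 (Set.Ioi 0)) (nhds B) := by
    have : Continuous (fun s : ℝ => B + s * K) := by fun_prop
    have h2 := this.tendsto 0
    simp only [zero_mul, add_zero] at h2
    exact h2.mono_left nhdsWithin_le_nhds
  refine ge_of_tendsto ht ?_
  filter_upwards [Ioc_mem_nhdsGT (zero_lt_one (α := ℝ))] with s hs
  exact h s hs.1 hs.2

theorem aux_prox {E : Type*} [NormedAddCommGroup E] [InnerProductSpace ℝ E]
    (r : E → ℝ) (D : Set E) (α : ℝ) (x g y z : E) (hα : 0 < α)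
    (hr : ConvexOn ℝ D r) (hy : IsProxPt r D α (x - α • g) y) (hz : z ∈ D) :
    r y ≤ r z + inner ℝ g (z - y) + 1 / α * inner ℝ (y - x) (z - y) := by
  obtain ⟨hyD, hmin⟩ := hy
  apply aux_limit _ _ (1 / (2 * α) * ‖z - y‖ ^ 2)
  intro s hs hs1
  have hmem : (1 - s) • y + s • z ∈ D := hr.1 hyD hz (by linarith) hs.le (by ring)
  have hc := hr.2 hyD hz (by linarith : 0 ≤ 1 - s) hs.le (by ring)
  have hm := hmin _ hmem
  have e : (1 - s) • y + s • z - (x - α • g) = (y - (x - α • g)) + s • (z - y) := by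
    module
  have e2 : y - (x - α • g) = (y - x) + α • g := by abel
  rw [e, norm_add_sq_real, norm_smul, real_inner_smul_right] at hm
  have e3 : inner ℝ (y - (x - α • g)) (z - y)
      = inner ℝ (y - x) (z - y) + α * inner ℝ g (z - y) := by
    rw [e2, inner_add_left, real_inner_smul_left]
  rw [e3, mul_pow, Real.norm_eq_abs, sq_abs] at hm
  simp only [smul_eq_mul] at hc
  have e4 : 1 / (2 * α) * (2 * (s * (inner ℝ (y - x) (z - y) + α * inner ℝ g (z - y))))
     = s * (inner ℝ g (z - y) + 1 / α * inner ℝ (y - x) (z - y)) := by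
    field_simp
    ring
  have h5 : s * r y ≤ s * (r z + inner ℝ g (z - y) + 1 / α * inner ℝ (y - x) (z - y)
      + s * (1 / (2 * α) * ‖z - y‖ ^ 2)) := by
    linarith
  exact le_of_mul_le_mul_left h5 hs

/-- One-block descent inequality (inequality (recursion-bd0) in the paper): with
`x̄_i = prox_{α_i r_i}(x_i - α_i ∇_{x_i} f̄(x))`,
`x⁺_i = prox_{α_i r_i}(x_i - α_i (∇_{x_i} f̄(x) + w))` and `x⁺_j = x_j` for `j ≠ i`, one has
`F(x⁺) ≤ F(x) + (L_i/2 - 1/(2α_i))‖x⁺_i - x_i‖² + (α_i/2)‖w‖²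
  + (L_i - 1/(2α_i))‖x̄_i - x_i‖²`. -/
theorem stmt1 {n : ℕ} {d : Fin n → ℕ}
    (fbar : (∀ i, EuclideanSpace ℝ (Fin (d i))) → ℝ)
    (gradf : (∀ i, EuclideanSpace ℝ (Fin (d i))) → ∀ i, EuclideanSpace ℝ (Fin (d i)))
    (r : ∀ i, EuclideanSpace ℝ (Fin (d i)) → ℝ)
    (D : ∀ i, Set (EuclideanSpace ℝ (Fin (d i))))
    (L : Fin n → ℝ)
    (hDconv : ∀ i, Convex ℝ (D i)) (hDcomp : ∀ i, IsCompact (D i))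
    (hDne : ∀ i, (D i).Nonempty)
    (hrconv : ∀ i, ConvexOn ℝ (D i) (r i))
    (hrlsc : ∀ i, LowerSemicontinuousOn (r i) (D i))
    (hgrad : ∀ (u : ∀ i, EuclideanSpace ℝ (Fin (d i))) (i : Fin n),
      HasGradientAt (fun t => fbar (Function.update u i t)) (gradf u i) (u i))
    (hLpos : ∀ i, 0 < L i)
    (hsmooth : ∀ (u : ∀ i, EuclideanSpace ℝ (Fin (d i))), (∀ j, u j ∈ D j) →
      ∀ i, ∀ ui' ∈ D i, ‖gradf u i - gradf (Function.update u i ui') i‖ ≤ L i * ‖u i - ui'‖)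
    (i : Fin n) (x : ∀ j, EuclideanSpace ℝ (Fin (d j))) (hx : ∀ j, x j ∈ D j)
    (w : EuclideanSpace ℝ (Fin (d i))) (αi : ℝ) (hαi : 0 < αi)
    (xbari xplusi : EuclideanSpace ℝ (Fin (d i)))
    (hxbar : IsProxPt (r i) (D i) αi (x i - αi • gradf x i) xbari)
    (hxplus : IsProxPt (r i) (D i) αi (x i - αi • (gradf x i + w)) xplusi) :
    fbar (Function.update x i xplusi) + ∑ j, r j (Function.update x i xplusi j) ≤
      fbar x + ∑ j, r j (x j) + (L i / 2 - 1 / (2 * αi)) * ‖xplusi - x i‖ ^ 2 +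
        αi / 2 * ‖w‖ ^ 2 + (L i - 1 / (2 * αi)) * ‖xbari - x i‖ ^ 2 := by
  set p := x i with hp
  have hxp := hxplus.1
  -- descent lemma
  have hdesc : fbar (Function.update x i xplusi) ≤ fbar x + inner ℝ (gradf x i) (xplusi - p)
      + L i / 2 * ‖xplusi - p‖ ^ 2 := by
    set a := xplusi - p with ha
    set φ' : ℝ → ℝ := fun t => inner ℝ (gradf (Function.update x i (p + t • a)) i) a with hφ'
    have hder : ∀ t : ℝ, HasDerivAt (fun t : ℝ => fbar (Function.update x i (p + t • a)))
        (φ' t) t := by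
      intro t
      have h1 := (hgrad (Function.update x i (p + t • a)) i).hasFDerivAt
      simp only [Function.update_idem, Function.update_self] at h1
      have h2 : HasDerivAt (fun t : ℝ => p + t • a) a t := by
        simpa using ((hasDerivAt_id t).smul_const a).const_add p
      have h3 := h1.comp_hasDerivAt t h2
      simpa [hφ', Function.comp_def] using h3
    have hψ : ∀ t : ℝ, HasDerivAt (fun t : ℝ => fbar (Function.update x i (p + t • a))
        - (t * inner ℝ (gradf x i) a + t ^ 2 * (L i / 2 * ‖a‖ ^ 2)))
        (φ' t - (inner ℝ (gradf x i) a + 2 * t * (L i / 2 * ‖a‖ ^ 2))) t := by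
      intro t
      refine (hder t).sub (HasDerivAt.add ?_ ?_)
      · simpa using (hasDerivAt_id t).mul_const (inner ℝ (gradf x i) a)
      · simpa using (hasDerivAt_pow 2 t).mul_const (L i / 2 * ‖a‖ ^ 2)
    have hanti := antitoneOn_of_deriv_nonpos (convex_Icc (0 : ℝ) 1)
      (fun t _ => (hψ t).continuousAt.continuousWithinAt)
      (fun t _ => (hψ t).differentiableAt.differentiableWithinAt)
      (by
        intro t ht
        rw [interior_Icc] at ht
        rw [(hψ t).deriv]
        have hmem : p + t • a ∈ D i := by
          have := hDconv i (hx i) hxp (by linarith [ht.2] : 0 ≤ 1 - t) ht.1.le (by ring)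
          convert this using 1
          rw [ha]
          module
        have hs := hsmooth x hx i _ hmem
        rw [norm_sub_rev] at hs
        have hn : ‖x i - (p + t • a)‖ = t * ‖a‖ := by
          rw [← hp, sub_add_cancel_left, norm_neg, norm_smul, Real.norm_eq_abs,
            abs_of_pos ht.1]
        rw [hn] at hs
        have hcs := real_inner_le_norm (gradf (Function.update x i (p + t • a)) i - gradf x i) a
        rw [inner_sub_left] at hcs
        have := mul_le_mul_of_nonneg_right hs (norm_nonneg a)
        simp only [hφ']
        nlinarith)
    have h01 := hanti (Set.left_mem_Icc.2 zero_le_one) (Set.right_mem_Icc.2 zero_le_one) zero_le_one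
    have hpa : p + a = xplusi := by rw [ha]; abel
    simp only [one_smul, zero_smul, add_zero, hpa] at h01
    rw [hp, Function.update_eq_self] at h01
    linarith
  have hsum : ∑ j, r j (Function.update x i xplusi j) - ∑ j, r j (x j)
      = r i xplusi - r i p := by
    rw [← Finset.sum_sub_distrib, Finset.sum_eq_single i]
    · simp [hp]
    · intro j _ hj
      simp [Function.update_of_ne hj]
    · simp
  have hA := aux_prox (r i) (D i) αi p (gradf x i + w) xplusi xbari hαi (hrconv i) hxplus hxbar.1
  have hB := aux_prox (r i) (D i) αi p (gradf x i) xbari p hαi (hrconv i) hxbar (hx i)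
  obtain ⟨a, rfl⟩ : ∃ a, xplusi = p + a := ⟨xplusi - p, by abel⟩
  obtain ⟨b, rfl⟩ : ∃ b, xbari = p + b := ⟨xbari - p, by abel⟩
  simp only [add_sub_cancel_left, add_sub_add_left_eq_sub, sub_add_cancel_left] at *
  rw [inner_neg_right, inner_neg_right, real_inner_self_eq_norm_sq] at hB
  have hy : 0 ≤ ‖αi • w - (b - a)‖ ^ 2 := by positivity
  rw [norm_sub_sq_real, norm_smul, real_inner_smul_left, Real.norm_eq_abs, mul_pow, sq_abs,
    norm_sub_sq_real] at hy
  rw [inner_add_left, inner_sub_right (gradf x i), inner_sub_right a,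
    real_inner_self_eq_norm_sq] at hA
  rw [real_inner_comm a b] at hy
  have hy2 : inner ℝ w (b - a) ≤ αi / 2 * ‖w‖ ^ 2
      + 1 / (2 * αi) * (‖b‖ ^ 2 - 2 * inner ℝ a b + ‖a‖ ^ 2) := by
    have : inner ℝ w (b - a) = 1 / (2 * αi) * (2 * (αi * inner ℝ w (b - a))) := by
      field_simp
    rw [this]
    have e : αi / 2 * ‖w‖ ^ 2 = 1 / (2 * αi) * (αi ^ 2 * ‖w‖ ^ 2) := by
      field_simp
    rw [e, ← mul_add]
    apply mul_le_mul_of_nonneg_left _ (by positivity)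
    linarith
  have hk : 1 / αi = 2 * (1 / (2 * αi)) := by field_simp
  rw [hk] at hA hB
  have hLb : 0 ≤ L i * ‖b‖ ^ 2 := mul_nonneg (hLpos i).le (by positivity)
  linarith

end
end

section
/- Suppose 0 < α_i ≤ 1/L_i for each i = 1,…,n. Then for every k ≥ 1 the iterates of the algorithm satisfy, almost surely, E[ F(x(k+1)) | F_k ] ≤ F(x(k)) − Σ_{i=1}^n p_i ( 1/(2α_i) − L_i ) ‖x̄_i(k+1) − x_i(k)‖² + (1/2) E[ α_{i_k} ‖w_{i_k}(k+1)‖² | F_k ]. -/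
open MeasureTheory ProbabilityTheory Real Finset
open scoped RealInnerProductSpace ENNReal

noncomputable section

theorem prox_var {E : Type*} [NormedAddCommGroup E] [InnerProductSpace ℝ E]
    {r : E → ℝ} {D : Set E} {α : ℝ} {u y : E} (hα : 0 < α) (hr : ConvexOn ℝ D r)
    (h : IsProxPt r D α u y) {z : E} (hz : z ∈ D) :
    α * r y ≤ α * r z + ⟪y - u, z - y⟫ := by
  obtain ⟨hy, hm⟩ := h
  have key : ∀ t : ℝ, 0 < t → t ≤ 1 →
      α * r y ≤ α * r z + ⟪y - u, z - y⟫ + t * (‖z - y‖ ^ 2 / 2) := by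
    intro t ht ht1
    have hc := hr.2 hy hz (by linarith : (0:ℝ) ≤ 1 - t) ht.le (by ring)
    have hd := hr.1 hy hz (by linarith : (0:ℝ) ≤ 1 - t) ht.le (by ring)
    have h1 := hm _ hd
    have e : (1 - t) • y + t • z - u = (y - u) + t • (z - y) := by
      module
    rw [e, norm_add_sq_real, inner_smul_right, norm_smul, Real.norm_eq_abs, mul_pow, sq_abs] at h1
    simp only [smul_eq_mul] at hc
    have h2 : r y + 1 / (2 * α) * ‖y - u‖ ^ 2 ≤ ((1 - t) * r y + t * r z) +
      1 / (2 * α) * (‖y - u‖ ^ 2 + 2 * (t * ⟪y - u, z - y⟫) + t ^ 2 * ‖z - y‖ ^ 2) := by linarith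
    have h3 := mul_le_mul_of_nonneg_left h2 hα.le
    have e1 : α * (1 / (2 * α)) = 1 / 2 := by field_simp
    rw [mul_add, mul_add, ← mul_assoc, ← mul_assoc, e1] at h3
    have h4 : t * (α * r y) ≤ t * (α * r z + ⟪y - u, z - y⟫ + t * (‖z - y‖ ^ 2 / 2)) := by
      nlinarith
    exact le_of_mul_le_mul_left h4 ht
  have hlim : Filter.Tendsto (fun t : ℝ => α * r z + ⟪y - u, z - y⟫ + t * (‖z - y‖ ^ 2 / 2))
      (nhdsWithin 0 (Set.Ioi 0)) (nhds (α * r z + ⟪y - u, z - y⟫)) := by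
    have : Continuous (fun t : ℝ => α * r z + ⟪y - u, z - y⟫ + t * (‖z - y‖ ^ 2 / 2)) := by
      fun_prop
    have h0 := this.tendsto 0
    simp only [zero_mul, add_zero] at h0
    exact h0.mono_left nhdsWithin_le_nhds
  refine ge_of_tendsto hlim ?_
  filter_upwards [Ioc_mem_nhdsGT (zero_lt_one' ℝ)] with t ht
  exact key t ht.1 ht.2

theorem prox_nonexp {E : Type*} [NormedAddCommGroup E] [InnerProductSpace ℝ E]
    {r : E → ℝ} {D : Set E} {α : ℝ} {u y u' y' : E} (hα : 0 < α) (hr : ConvexOn ℝ D r)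
    (h : IsProxPt r D α u y) (h' : IsProxPt r D α u' y') :
    ‖y - y'‖ ≤ ‖u - u'‖ := by
  have h1 := prox_var hα hr h h'.1
  have h2 := prox_var hα hr h' h.1
  have h3 : ‖y - y'‖ ^ 2 ≤ ⟪u - u', y - y'⟫ := by
    rw [← real_inner_self_eq_norm_sq]
    have e : ⟪u - u', y - y'⟫ - ⟪y - y', y - y'⟫ = ⟪y - u, y' - y⟫ + ⟪y' - u', y - y'⟫ := by
      simp only [inner_sub_left, inner_sub_right]; ring
    linarith
  have h4 := real_inner_le_norm (u - u') (y - y')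
  by_contra hc
  push Not at hc
  nlinarith [norm_nonneg (u - u'), norm_nonneg (y - y')]

theorem prox_step {E : Type*} [NormedAddCommGroup E] [InnerProductSpace ℝ E]
    {r : E → ℝ} {D : Set E} {α : ℝ} {x g w y xb : E} (hα : 0 < α) (hr : ConvexOn ℝ D r)
    (hx : x ∈ D)
    (h : IsProxPt r D α (x - α • (g + w)) y) (h' : IsProxPt r D α (x - α • g) xb) :
    r y + ⟪g, y - x⟫ + 1 / (2 * α) * ‖y - x‖ ^ 2 ≤
      r x - 1 / (2 * α) * ‖xb - x‖ ^ 2 + α / 2 * ‖w‖ ^ 2 := by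
  have h1 := prox_var hα hr h h'.1
  have h2 := prox_var hα hr h' hx
  have h3 : 0 ≤ ‖(y - xb) + α • w‖ ^ 2 := sq_nonneg _
  have key : α * (r y + ⟪g, y - x⟫) + 1 / 2 * ‖y - x‖ ^ 2 ≤
      α * r x - 1 / 2 * ‖xb - x‖ ^ 2 + α ^ 2 / 2 * ‖w‖ ^ 2 := by
    simp only [← real_inner_self_eq_norm_sq, inner_sub_left, inner_sub_right, inner_add_left,
      inner_add_right, inner_smul_left, inner_smul_right, RCLike.conj_to_real] at *
    simp only [real_inner_comm x y, real_inner_comm x xb, real_inner_comm xb y,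
      real_inner_comm w y, real_inner_comm w xb] at *
    nlinarith
  have e1 : α * (1 / (2 * α)) = 1 / 2 := by field_simp
  refine le_of_mul_le_mul_left ?_ hα
  calc _ = α * (r y + ⟪g, y - x⟫) + (α * (1 / (2 * α))) * ‖y - x‖ ^ 2 := by ring
    _ ≤ α * r x - (α * (1 / (2 * α))) * ‖xb - x‖ ^ 2 + α ^ 2 / 2 * ‖w‖ ^ 2 := by rw [e1]; exact key
    _ = _ := by ring

theorem descent {E : Type*} [NormedAddCommGroup E] [InnerProductSpace ℝ E] [CompleteSpace E]
    {f : E → ℝ} {G : E → E} {D : Set E} {L : ℝ} (hD : Convex ℝ D)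
    (hf : ∀ t, HasGradientAt f (G t) t) {a b : E} (ha : a ∈ D) (hb : b ∈ D)
    (hL : ∀ t ∈ D, ‖G a - G t‖ ≤ L * ‖a - t‖) :
    f b ≤ f a + ⟪G a, b - a⟫ + L / 2 * ‖b - a‖ ^ 2 := by
  set v := b - a with hv
  let h : ℝ → ℝ := fun s => f (a + s • v) - s * ⟪G a, v⟫ - L / 2 * ‖v‖ ^ 2 * s ^ 2
  have hd : ∀ s, HasDerivAt h (⟪G (a + s • v), v⟫ - ⟪G a, v⟫ - L / 2 * ‖v‖ ^ 2 * (2 * s)) s := by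
    intro s
    have h1 : HasDerivAt (fun s : ℝ => a + s • v) v s := by
      simpa using ((hasDerivAt_id s).smul_const v).const_add a
    have h2 := (hf (a + s • v)).hasFDerivAt.comp_hasDerivAt s h1
    have h3 : HasDerivAt (fun s : ℝ => s * ⟪G a, v⟫) ⟪G a, v⟫ s := by
      simpa using (hasDerivAt_id s).mul_const ⟪G a, v⟫
    have h4 : HasDerivAt (fun s : ℝ => L / 2 * ‖v‖ ^ 2 * s ^ 2) (L / 2 * ‖v‖ ^ 2 * (2 * s)) s := by
      simpa using (hasDerivAt_pow 2 s).const_mul (L / 2 * ‖v‖ ^ 2)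
    have h5 : (InnerProductSpace.toDual ℝ E) (G (a + s • v)) v = ⟪G (a + s • v), v⟫ := by simp
    rw [h5] at h2
    exact (h2.sub h3).sub h4
  have hanti : AntitoneOn h (Set.Icc 0 1) := by
    refine antitoneOn_of_deriv_nonpos (convex_Icc 0 1) ?_ ?_ ?_
    · exact fun s _ => (hd s).continuousAt.continuousWithinAt
    · exact fun s _ => (hd s).differentiableAt.differentiableWithinAt
    · intro s hs
      rw [interior_Icc] at hs
      rw [(hd s).deriv]
      have hm : a + s • v ∈ D := by
        have := hD ha hb (by linarith [hs.2] : (0:ℝ) ≤ 1 - s) hs.1.le (by ring)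
        convert this using 1
        rw [hv]; module
      have h1 := hL _ hm
      rw [sub_add_cancel_left, norm_neg, norm_smul, Real.norm_eq_abs, abs_of_pos hs.1,
        norm_sub_rev] at h1
      have h2 := real_inner_le_norm (G (a + s • v) - G a) v
      rw [inner_sub_left] at h2
      have h3 := mul_le_mul_of_nonneg_right h1 (norm_nonneg v)
      nlinarith
  have := hanti (by simp) (by simp) (zero_le_one' ℝ)
  simp only [h, one_smul, zero_smul, add_zero] at this
  rw [show a + v = b by rw [hv]; abel] at this
  linarith

section meas
variable {n : ℕ} {d : Fin n → ℕ}

theorem sep_meas {fbar : (∀ i, EuclideanSpace ℝ (Fin (d i))) → ℝ}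
    (hc : ∀ u i, Continuous (fun t => fbar (Function.update u i t))) : Measurable fbar := by
  have key : ∀ s : Finset (Fin n), ∀ u0 : (∀ i, EuclideanSpace ℝ (Fin (d i))),
      Measurable (fun u : (∀ i, EuclideanSpace ℝ (Fin (d i))) => fbar (s.piecewise u u0)) := by
    intro s
    induction s using Finset.induction_on with
    | empty => intro u0; simp
    | insert i s hi ih =>
      intro u0
      have h1 : Measurable (Function.uncurry
          (fun (t : EuclideanSpace ℝ (Fin (d i))) (u : (∀ i, EuclideanSpace ℝ (Fin (d i)))) =>
            fbar (Function.update (s.piecewise u u0) i t))) := by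
        refine measurable_uncurry_of_continuous_of_measurable (fun u => hc _ i) ?_
        intro t
        convert ih (Function.update u0 i t) using 2 with u
        congr 1
        ext1 j
        by_cases hj : j = i
        · subst hj; simp [hi]
        · by_cases hjs : j ∈ s <;> simp [hj, hjs]
      have h2 := h1.comp (Measurable.prodMk (f := fun u : (∀ i, EuclideanSpace ℝ (Fin (d i))) => u i)
        (g := fun u => u) (measurable_pi_apply i) measurable_id)
      convert h2 using 2 with u
      simp [Function.uncurry, Finset.piecewise_insert]
  rcases isEmpty_or_nonempty (∀ i, EuclideanSpace ℝ (Fin (d i))) with h | ⟨⟨u0⟩⟩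
  · exact measurable_of_empty _
  · simpa using key Finset.univ u0

theorem grad_meas {fbar : (∀ i, EuclideanSpace ℝ (Fin (d i))) → ℝ}
    {gradf : (∀ i, EuclideanSpace ℝ (Fin (d i))) → ∀ i, EuclideanSpace ℝ (Fin (d i))}
    (hf : Measurable fbar)
    (hgrad : ∀ (u : ∀ i, EuclideanSpace ℝ (Fin (d i))) (i : Fin n),
      HasGradientAt (fun t => fbar (Function.update u i t)) (gradf u i) (u i)) (i : Fin n) :
    Measurable (fun u => gradf u i) := by
  have hj : ∀ j, Measurable (fun u => gradf u i j) := by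
    intro j
    let e : EuclideanSpace ℝ (Fin (d i)) := EuclideanSpace.single j 1
    refine measurable_of_tendsto_metrizable (f := fun (m : ℕ) u =>
      ((m : ℝ) + 1) * (fbar (Function.update u i (u i + (1 / ((m : ℝ) + 1)) • e)) - fbar u)) ?_ ?_
    · intro m
      refine measurable_const.mul ((hf.comp ?_).sub hf)
      refine measurable_pi_lambda _ fun l => ?_
      by_cases hl : l = i
      · subst hl
        simp only [Function.update_self]
        exact (measurable_pi_apply l).add_const _
      · simp only [Function.update_of_ne hl]
        exact measurable_pi_apply l
    · rw [tendsto_pi_nhds]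
      intro u
      have h1 : HasDerivAt (fun s : ℝ => u i + s • e) e 0 := by
        simpa using ((hasDerivAt_id (0:ℝ)).smul_const e).const_add (u i)
      have h0 := (hgrad u i).hasFDerivAt
      have h2 := HasFDerivAt.comp_hasDerivAt (x := (0:ℝ)) (f := fun s : ℝ => u i + s • e)
        (l := fun t => fbar (Function.update u i t)) (by simpa using h0) h1
      have h3 := h2.tendsto_slope_zero
      have h4 : Filter.Tendsto (fun m : ℕ => 1 / ((m:ℝ) + 1)) Filter.atTop
          (nhdsWithin 0 {0}ᶜ) := by
        rw [tendsto_nhdsWithin_iff]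
        refine ⟨tendsto_one_div_add_atTop_nhds_zero_nat, ?_⟩
        filter_upwards with m
        simp only [Set.mem_compl_iff, Set.mem_singleton_iff]
        positivity
      have h5 := h3.comp h4
      have e2 : (InnerProductSpace.toDual ℝ (EuclideanSpace ℝ (Fin (d i)))) (gradf u i) e
          = gradf u i j := by
        simp [e, EuclideanSpace.inner_single_right]
      rw [e2] at h5
      convert h5 using 2 with m
      simp
  have h1 : Measurable (fun u => (fun j => gradf u i j : Fin (d i) → ℝ)) :=
    measurable_pi_lambda _ hj
  exact (MeasurableEquiv.toLp 2 (Fin (d i) → ℝ)).measurable.comp h1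

end meas

theorem prox_meas {E : Type*} [NormedAddCommGroup E] [InnerProductSpace ℝ E] [MeasurableSpace E]
    [BorelSpace E] {Ω : Type*} {m : MeasurableSpace Ω}
    {r : E → ℝ} {D : Set E} {α : ℝ} {u y : Ω → E} (hα : 0 < α) (hr : ConvexOn ℝ D r)
    (hu : Measurable u) (h : ∀ ω, IsProxPt r D α (u ω) (y ω)) : Measurable y := by
  let S := {v | ∃ z, IsProxPt r D α v z}
  let P : S → E := fun v => v.2.choose
  have hP : ∀ v : S, IsProxPt r D α v (P v) := fun v => v.2.choose_spec
  have hPc : Continuous P := by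
    refine LipschitzWith.continuous (K := 1) (LipschitzWith.of_dist_le_mul fun a b => ?_)
    rw [dist_eq_norm, Subtype.dist_eq, dist_eq_norm]
    simpa using prox_nonexp hα hr (hP a) (hP b)
  have : y = P ∘ (fun ω => (⟨u ω, y ω, h ω⟩ : S)) := by
    ext1 ω
    have := prox_nonexp hα hr (h ω) (hP ⟨u ω, y ω, h ω⟩)
    simp only [sub_self, norm_zero, norm_le_zero_iff, sub_eq_zero] at this
    exact this
  rw [this]
  exact hPc.measurable.comp hu.subtype_mk

theorem lsc_meas {E : Type*} [TopologicalSpace E] [MeasurableSpace E]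
    [BorelSpace E] {Ω : Type*} {m : MeasurableSpace Ω}
    {r : E → ℝ} {D : Set E} {u : Ω → E} (hr : LowerSemicontinuousOn r D)
    (hu : Measurable u) (h : ∀ ω, u ω ∈ D) : Measurable (fun ω => r (u ω)) := by
  have h1 : LowerSemicontinuous (D.domRestrict r) := lowerSemicontinuous_restrict_iff.2 hr
  exact h1.measurable.comp (hu.subtype_mk (h := h))

set_option maxHeartbeats 1000000 in
/-- Key recursion (Lemma 2 of the paper): if `0 < α_i ≤ 1/L_i` for each block, then for each
`k ≥ 1`, almost surely,
`E[F(x(k+1)) | ℱ_k] ≤ F(x(k)) - ∑_i p_i (1/(2α_i) - L_i)‖x̄_i(k+1) - x_i(k)‖²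
  + (1/2) E[α_{i_k}‖w_{i_k}(k+1)‖² | ℱ_k]`. -/
theorem stmt2
    {n : ℕ} {d : Fin n → ℕ}
    {Ω : Type*} {mΩ : MeasurableSpace Ω} {μ : Measure Ω} [IsProbabilityMeasure μ]
    (ℱ : Filtration ℕ mΩ)
    (fbar : (∀ i, EuclideanSpace ℝ (Fin (d i))) → ℝ)
    (gradf : (∀ i, EuclideanSpace ℝ (Fin (d i))) → ∀ i, EuclideanSpace ℝ (Fin (d i)))
    (r : ∀ i, EuclideanSpace ℝ (Fin (d i)) → ℝ)
    (D : ∀ i, Set (EuclideanSpace ℝ (Fin (d i))))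
    (L α p : Fin n → ℝ) (σ : ℝ) (hσ : 0 < σ) (Fstar : ℝ)
    (x : ℕ → Ω → ∀ i, EuclideanSpace ℝ (Fin (d i)))
    (w : ∀ i : Fin n, ℕ → Ω → EuclideanSpace ℝ (Fin (d i)))
    (idx : ℕ → Ω → Fin n)
    (N : Fin n → ℕ → Ω → ℕ)
    -- the regularizers: proper lsc convex with compact effective domain
    (hDconv : ∀ i, Convex ℝ (D i)) (hDcomp : ∀ i, IsCompact (D i))
    (hDne : ∀ i, (D i).Nonempty)
    (hrconv : ∀ i, ConvexOn ℝ (D i) (r i))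
    (hrlsc : ∀ i, LowerSemicontinuousOn (r i) (D i))
    -- `gradf u i` is the block partial gradient `∇_{x_i} f̄(u)`
    (hgrad : ∀ (u : ∀ i, EuclideanSpace ℝ (Fin (d i))) (i : Fin n),
      HasGradientAt (fun t => fbar (Function.update u i t)) (gradf u i) (u i))
    (hLpos : ∀ i, 0 < L i)
    -- blockwise `L_i`-smoothness of `f̄`
    (hsmooth : ∀ (u : ∀ i, EuclideanSpace ℝ (Fin (d i))), (∀ j, u j ∈ D j) →
      ∀ i, ∀ ui' ∈ D i, ‖gradf u i - gradf (Function.update u i ui') i‖ ≤ L i * ‖u i - ui'‖)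
    -- `F` attains its minimum value `F*` on the effective domain
    (hFstar : IsLeast ((fun u => fbar u + ∑ i, r i (u i)) '' {u | ∀ j, u j ∈ D j}) Fstar)
    (hp : ∀ i, 0 < p i ∧ p i < 1) (hpsum : ∑ i, p i = 1)
    (hαpos : ∀ i, 0 < α i)
    -- the iterates stay in the effective domain and are adapted
    (hxdom : ∀ k ω i, x k ω i ∈ D i)
    (hadapt : ∀ k, StronglyMeasurable[ℱ k] (x k))
    -- block selection: `P(i_k = i) = p_i`, independent of `ℱ_k`
    (hidxmeas : ∀ k, Measurable (idx k))
    (hidxdist : ∀ k i, μ {ω | idx k ω = i} = ENNReal.ofReal (p i))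
    (hidxindep : ∀ k, Indep (MeasurableSpace.comap (idx k) inferInstance) (ℱ k) μ)
    -- batch sizes: positive and adapted
    (hNpos : ∀ i k ω, 0 < N i k ω)
    (hNadapt : ∀ i k, Measurable[ℱ k] (N i k))
    -- noise: `E[‖w_i(k+1)‖² | ℱ_k] ≤ σ²/N_i(k)` a.s.
    (hnoise : ∀ (i : Fin n) (k : ℕ), ∀ᵐ ω ∂μ,
      (μ[fun ω' => ‖w i (k + 1) ω'‖ ^ 2|ℱ k]) ω ≤ σ ^ 2 / (N i k ω : ℝ))
    (hwint : ∀ (i : Fin n) (k : ℕ), Integrable (fun ω => ‖w i (k + 1) ω‖ ^ 2) μ)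
    -- the update: chosen block does a proximal stochastic-gradient step, others stay put
    (hupdate : ∀ (k : ℕ) (ω : Ω),
      IsProxPt (r (idx k ω)) (D (idx k ω)) (α (idx k ω))
          (x k ω (idx k ω) -
            α (idx k ω) • (gradf (x k ω) (idx k ω) + w (idx k ω) (k + 1) ω))
          (x (k + 1) ω (idx k ω)) ∧
        ∀ j, j ≠ idx k ω → x (k + 1) ω j = x k ω j)
    (hFint : ∀ k, Integrable (fun ω => fbar (x k ω) + ∑ i, r i (x k ω i)) μ)
    -- `x̄_i(k+1) = prox_{α_i r_i}(x_i(k) - α_i ∇_{x_i} f̄(x(k)))`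
    (xbar : ∀ i : Fin n, ℕ → Ω → EuclideanSpace ℝ (Fin (d i)))
    (hxbar : ∀ (i : Fin n) (k : ℕ) (ω : Ω),
      IsProxPt (r i) (D i) (α i) (x k ω i - α i • gradf (x k ω) i) (xbar i k ω))
    -- steplength condition
    (hα : ∀ i, α i ≤ 1 / L i)
    (k : ℕ) (hk : 1 ≤ k) :
    ∀ᵐ ω ∂μ,
      (μ[fun ω' => fbar (x (k + 1) ω') + ∑ i, r i (x (k + 1) ω' i)|ℱ k]) ω ≤
        (fbar (x k ω) + ∑ i, r i (x k ω i)) -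
            (∑ i, p i * (1 / (2 * α i) - L i) * ‖xbar i k ω - x k ω i‖ ^ 2) +
          1 / 2 * (μ[fun ω' => α (idx k ω') * ‖w (idx k ω') (k + 1) ω'‖ ^ 2|ℱ k]) ω := by
  -- block regularity
  have hgradU : ∀ (u : ∀ i, EuclideanSpace ℝ (Fin (d i))) (i : Fin n) t,
      HasGradientAt (fun t => fbar (Function.update u i t)) (gradf (Function.update u i t) i) t := by
    intro u i t
    have := hgrad (Function.update u i t) i
    simpa only [Function.update_idem, Function.update_self] using this
  have hfmeas : Measurable fbar := sep_meas fun u i =>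
    continuous_iff_continuousAt.2 fun t => (hgradU u i t).continuousAt
  have hxm : Measurable[ℱ k] (x k) := (hadapt k).measurable
  have hxim : ∀ i, Measurable[ℱ k] (fun ω => x k ω i) := fun i => (measurable_pi_apply i).comp hxm
  have hgm : ∀ i, Measurable[ℱ k] (fun ω => gradf (x k ω) i) := fun i =>
    (grad_meas hfmeas hgrad i).comp hxm
  have hxbm : ∀ i, Measurable[ℱ k] (xbar i k) := by
    intro i
    have h1 : Measurable[ℱ k] (fun ω => x k ω i - α i • gradf (x k ω) i) :=
      (hxim i).sub ((hgm i).const_smul (α i))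
    exact prox_meas (m := ℱ k) (hαpos i) (hrconv i) h1 (hxbar i k)
  have hFm : Measurable[ℱ k] (fun ω => fbar (x k ω) + ∑ i, r i (x k ω i)) := by
    have h1 : Measurable[ℱ k] (fun ω => fbar (x k ω)) := hfmeas.comp hxm
    have h2 : ∀ i, Measurable[ℱ k] (fun ω => r i (x k ω i)) := fun i =>
      lsc_meas (hrlsc i) (hxim i) (fun ω => hxdom k ω i)
    exact h1.add (Finset.measurable_fun_sum Finset.univ (fun i _ => h2 i))
  have hqm : ∀ i, Measurable[ℱ k] (fun ω => ‖xbar i k ω - x k ω i‖ ^ 2) := by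
    intro i
    have h1 : Measurable[ℱ k] (fun ω => xbar i k ω - x k ω i) :=
      (hxbm i).sub (hxim i)
    have h2 : Continuous (fun v : EuclideanSpace ℝ (Fin (d i)) => ‖v‖ ^ 2) := by fun_prop
    exact h2.measurable.comp h1
  have hqint : ∀ i, Integrable (fun ω => ‖xbar i k ω - x k ω i‖ ^ 2) μ := by
    intro i
    obtain ⟨C, hC⟩ := (hDcomp i).isBounded.exists_norm_le
    refine Integrable.of_bound (C := (C + C) ^ 2)
      ((hqm i).mono (ℱ.le k) le_rfl).aestronglyMeasurable (Filter.Eventually.of_forall fun ω => ?_)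
    rw [Real.norm_eq_abs, abs_of_nonneg (sq_nonneg _)]
    have := norm_sub_le (xbar i k ω) (x k ω i)
    have h1 := hC _ (hxbar i k ω).1
    have h2 := hC _ (hxdom k ω i)
    exact pow_le_pow_left₀ (norm_nonneg _) (by linarith) 2
  -- pathwise inequality
  let F : ℕ → Ω → ℝ := fun k ω => fbar (x k ω) + ∑ i, r i (x k ω i)
  let H : Fin n → Ω → ℝ := fun i ω =>
    F k ω - (1 / (2 * α i) - L i) * ‖xbar i k ω - x k ω i‖ ^ 2
  let W : Ω → ℝ := fun ω => α (idx k ω) * ‖w (idx k ω) (k + 1) ω‖ ^ 2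
  have hpath : ∀ ω, F (k + 1) ω ≤ H (idx k ω) ω + 1 / 2 * W ω := by
    intro ω
    obtain ⟨hpr, hstay⟩ := hupdate k ω
    have hb := hxbar (idx k ω) k ω
    simp only [F, H, W]
    generalize idx k ω = i at *
    have hup : x (k + 1) ω = Function.update (x k ω) i (x (k + 1) ω i) := by
      ext1 j
      by_cases hj : j = i
      · subst hj; simp
      · rw [Function.update_of_ne hj, hstay j hj]
    have hstep := prox_step (hαpos i) (hrconv i) (hxdom k ω i) hpr hb
    have hdesc := descent (L := L i) (hDconv i) (hgradU (x k ω) i) (hxdom k ω i)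
      (hxdom (k + 1) ω i) (by
        intro t ht
        rw [Function.update_eq_self]
        exact hsmooth (x k ω) (hxdom k ω) i t ht)
    rw [← hup, Function.update_eq_self] at hdesc
    have hsum : ∑ j, r j (x (k + 1) ω j) - ∑ j, r j (x k ω j) =
        r i (x (k + 1) ω i) - r i (x k ω i) := by
      rw [← Finset.sum_sub_distrib]
      refine Finset.sum_eq_single i (fun j _ hj => ?_) (by simp)
      rw [hstay j hj, sub_self]
    have hLα : L i / 2 ≤ 1 / (2 * α i) := by
      have h1 := hα i
      rw [le_div_iff₀ (hLpos i)] at h1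
      rw [div_le_div_iff₀ two_pos (by linarith [hαpos i])]
      linarith
    have h1 := mul_le_mul_of_nonneg_right hLα (sq_nonneg ‖x (k + 1) ω i - x k ω i‖)
    have h2 := mul_nonneg (hLpos i).le (sq_nonneg ‖xbar i k ω - x k ω i‖)
    linarith
  -- indicator decomposition
  let A : Fin n → Ω → ℝ := fun i => (idx k ⁻¹' {i}).indicator (fun _ => (1 : ℝ))
  have hdec : ∀ (g : Fin n → Ω → ℝ) ω, g (idx k ω) ω = ∑ i, A i ω * g i ω := by
    intro g ω
    rw [Finset.sum_eq_single (idx k ω)]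
    · simp [A]
    · intro b _ hb
      simp [A, Set.indicator, hb.symm]
    · simp
  have hAset : ∀ i, MeasurableSet (idx k ⁻¹' {i}) := fun i =>
    hidxmeas k (measurableSet_singleton i)
  have hAint : ∀ i, Integrable (A i) μ := fun i =>
    (integrable_const (1 : ℝ)).indicator (hAset i)
  have hAmul : ∀ i (g : Ω → ℝ), Integrable g μ → Integrable (fun ω => A i ω * g ω) μ := by
    intro i g hg
    refine (hg.indicator (hAset i)).congr (Filter.Eventually.of_forall fun ω => ?_)
    by_cases h : idx k ω = i <;> simp [A, Set.indicator, h]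
  have hHint : ∀ i, Integrable (H i) μ := fun i => (hFint k).sub ((hqint i).const_mul _)
  have hHm : ∀ i, StronglyMeasurable[ℱ k] (H i) := by
    intro i
    refine Measurable.stronglyMeasurable ?_
    exact hFm.sub ((hqm i).const_mul _)
  have hWint : Integrable W μ := by
    have : W = fun ω => ∑ i, A i ω * (α i * ‖w i (k + 1) ω‖ ^ 2) :=
      funext fun ω => hdec (fun i ω => α i * ‖w i (k + 1) ω‖ ^ 2) ω
    rw [this]
    exact integrable_finsetSum _ fun i _ => hAmul i _ ((hwint i k).const_mul _)
  have hHidx : (fun ω => H (idx k ω) ω) = ∑ i, A i * H i := by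
    ext ω
    rw [hdec H ω]; simp
  have hHidxint : Integrable (fun ω => H (idx k ω) ω) μ := by
    rw [hHidx]
    exact integrable_finsetSum' _ fun i _ => hAmul i _ (hHint i)
  have hAce : ∀ i, μ[A i|ℱ k] =ᵐ[μ] fun _ => p i := by
    intro i
    have h1 : StronglyMeasurable[MeasurableSpace.comap (idx k) inferInstance] (A i) :=
      stronglyMeasurable_const.indicator ⟨{i}, measurableSet_singleton i, rfl⟩
    have h2 := condExp_indep_eq (hidxmeas k).comap_le (ℱ.le k) h1 (hidxindep k)
    have h3 : ∫ ω, A i ω ∂μ = p i := by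
      simp only [A]
      rw [integral_indicator_const _ (hAset i)]
      have : μ (idx k ⁻¹' {i}) = ENNReal.ofReal (p i) := hidxdist k i
      simp [measureReal_def, this, (hp i).1.le]
    rw [h3] at h2
    exact h2
  have hAH : ∀ i, μ[A i * H i|ℱ k] =ᵐ[μ] fun ω => p i * H i ω := by
    intro i
    have h1 := condExp_mul_of_stronglyMeasurable_right (hHm i) (hAmul i _ (hHint i)) (hAint i)
    filter_upwards [h1, hAce i] with ω h1 h2
    rw [h1, Pi.mul_apply, h2]
  have hce1 : μ[fun ω => H (idx k ω) ω|ℱ k] =ᵐ[μ] fun ω => ∑ i, p i * H i ω := by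
    rw [hHidx]
    have h1 := condExp_finsetSum (μ := μ) (s := Finset.univ) (f := fun i => A i * H i)
      (fun i _ => hAmul i _ (hHint i)) (ℱ k)
    have h2 : ∀ᵐ ω ∂μ, ∀ i, (μ[A i * H i|ℱ k]) ω = p i * H i ω := ae_all_iff.2 hAH
    filter_upwards [h1, h2] with ω h1 h2
    rw [h1, Finset.sum_apply]
    exact Finset.sum_congr rfl fun i _ => h2 i
  have hmono : μ[F (k + 1)|ℱ k] ≤ᵐ[μ] μ[(fun ω => H (idx k ω) ω) + (1 / 2 : ℝ) • W|ℱ k] :=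
    condExp_mono (hFint (k + 1)) (hHidxint.add (hWint.smul (1 / 2 : ℝ)))
      (Filter.Eventually.of_forall fun ω => by simpa using hpath ω)
  have hadd := condExp_add hHidxint (hWint.smul (1 / 2 : ℝ)) (ℱ k)
  have hsm := condExp_smul (μ := μ) (1 / 2 : ℝ) W (ℱ k)
  filter_upwards [hmono, hadd, hsm, hce1] with ω h1 h2 h3 h4
  rw [h2, Pi.add_apply, h3, h4, Pi.smul_apply, smul_eq_mul] at h1
  refine h1.trans (le_of_eq ?_)
  congr 1
  simp only [H, mul_sub, Finset.sum_sub_distrib, ← Finset.sum_mul, hpsum, one_mul, F, sub_mul,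
    mul_assoc]

end
end

section
/- Suppose p_i = 1/n, α_i = 1/(4L_i), and the batch size is N_i(k) = (Γ_i(k) + 1)(Γ_i(k) + 2) for each i = 1,…,n. Then for every K ≥ 0: (1/(K+1)) Σ_{k=0}^K E[‖𝐆_α(x(k))‖²] ≤ 16 n L_max ( E[F(x(0))] − F* )/(K+1) + 2 n² σ² L_max ( Σ_{i=1}^n L_i^{−1} )/(K+1). Consequently, for any ε > 0, the iteration complexity to obtain an ε-stationary point (E[‖𝐆_α(x_{α,K})‖²] ≤ ε) is O(1/ε), and the expected number of sampled gradients used is O(1/ε³). -/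
open MeasureTheory ProbabilityTheory Real Finset
open scoped RealInnerProductSpace ENNReal

noncomputable section

theorem aux_prox_ineq {E : Type*} [NormedAddCommGroup E] [InnerProductSpace ℝ E]
    {r : E → ℝ} {D : Set E} {α : ℝ} (hα : 0 < α) (hr : ConvexOn ℝ D r) {u y z : E}
    (h : IsProxPt r D α u y) (hz : z ∈ D) :
    r y + 1 / (2 * α) * ‖y - u‖ ^ 2 + 1 / (2 * α) * ‖z - y‖ ^ 2
      ≤ r z + 1 / (2 * α) * ‖z - u‖ ^ 2 := by
  obtain ⟨hy, hmin⟩ := h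
  have key : ∀ t : ℝ, 0 < t → t < 1 →
      r y + 1 / (2 * α) * ‖y - u‖ ^ 2 + (1 - t) * (1 / (2 * α) * ‖z - y‖ ^ 2)
      ≤ r z + 1 / (2 * α) * ‖z - u‖ ^ 2 := by
    intro t ht0 ht1
    have h1 := hmin _ (hr.1 hy hz (sub_nonneg.2 ht1.le) ht0.le (by ring))
    have h2 := hr.2 hy hz (sub_nonneg.2 ht1.le) ht0.le (by ring)
    simp only [smul_eq_mul] at h2
    have h3 : ‖(1 - t) • y + t • z - u‖ ^ 2
        = (1 - t) * ‖y - u‖ ^ 2 + t * ‖z - u‖ ^ 2 - t * (1 - t) * ‖z - y‖ ^ 2 := by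
      have e1 : (1 - t) • y + t • z - u = (y - u) + t • (z - y) := by module
      have e2 : z - u = (y - u) + (z - y) := by abel
      rw [e1, e2, norm_add_sq_real, norm_add_sq_real, inner_smul_right, norm_smul,
        Real.norm_of_nonneg ht0.le]
      ring
    rw [h3] at h1
    have h4 : t * (r y + 1 / (2 * α) * ‖y - u‖ ^ 2 + (1 - t) * (1 / (2 * α) * ‖z - y‖ ^ 2))
        ≤ t * (r z + 1 / (2 * α) * ‖z - u‖ ^ 2) := by linarith
    exact le_of_mul_le_mul_left h4 ht0
  have hlim : Filter.Tendsto (fun t : ℝ => r y + 1 / (2 * α) * ‖y - u‖ ^ 2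
      + (1 - t) * (1 / (2 * α) * ‖z - y‖ ^ 2)) (nhdsWithin 0 (Set.Ioi 0))
      (nhds (r y + 1 / (2 * α) * ‖y - u‖ ^ 2 + (1 - 0) * (1 / (2 * α) * ‖z - y‖ ^ 2))) := by
    apply Filter.Tendsto.mono_left _ nhdsWithin_le_nhds
    apply Continuous.tendsto
    fun_prop
  have := le_of_tendsto hlim (b := r z + 1 / (2 * α) * ‖z - u‖ ^ 2) (by
    filter_upwards [Ioo_mem_nhdsGT (show (0:ℝ) < 1 by norm_num)] with t ht
    exact key t ht.1 ht.2)
  linarith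

theorem aux_prox_cont {E : Type*} [NormedAddCommGroup E] [InnerProductSpace ℝ E]
    {r : E → ℝ} {D : Set E} {α : ℝ} (hα : 0 < α) (hr : ConvexOn ℝ D r) {P : E → E}
    (h : ∀ u, IsProxPt r D α u (P u)) : Continuous P := by
  have : LipschitzWith 1 P := by
    apply LipschitzWith.of_dist_le_mul
    intro u v
    rw [dist_eq_norm, dist_eq_norm, NNReal.coe_one, one_mul]
    have h1 := aux_prox_ineq hα hr (h u) (h v).1
    have h2 := aux_prox_ineq hα hr (h v) (h u).1
    have h3 : ‖P v - P u‖ ^ 2 = ‖P u - P v‖ ^ 2 := by rw [norm_sub_rev]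
    have h4 : ‖P v - u‖ ^ 2 - ‖P u - u‖ ^ 2 + ‖P u - v‖ ^ 2 - ‖P v - v‖ ^ 2
        = 2 * ⟪u - v, P u - P v⟫ := by
      simp only [norm_sub_sq_real, inner_sub_left, inner_sub_right, real_inner_comm (P u),
        real_inner_comm (P v)]
      ring
    have h5 : 1 / (2 * α) * (2 * ‖P u - P v‖ ^ 2) ≤ 1 / (2 * α) * (2 * ⟪u - v, P u - P v⟫) := by
      rw [← h4]; rw [h3] at h1; linarith
    have h6 := le_of_mul_le_mul_left h5 (by positivity)
    have h7 := real_inner_le_norm (u - v) (P u - P v)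
    by_contra hc
    push Not at hc
    nlinarith [norm_nonneg (u - v), norm_nonneg (P u - P v)]
  exact this.continuous

theorem aux_descent_s6 {E : Type*} [NormedAddCommGroup E] [InnerProductSpace ℝ E] [CompleteSpace E]
    {f : E → ℝ} {g : E → E} {D : Set E} (hD : Convex ℝ D) {L : ℝ}
    (hg : ∀ t, HasGradientAt f (g t) t) {a b : E} (ha : a ∈ D) (hb : b ∈ D)
    (hs : ∀ t ∈ D, ‖g a - g t‖ ≤ L * ‖a - t‖) :
    f b ≤ f a + ⟪g a, b - a⟫ + L / 2 * ‖b - a‖ ^ 2 := by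
  have hder : ∀ t : ℝ, HasDerivAt (fun t : ℝ => f (a + t • (b - a)) - t * ⟪g a, b - a⟫
      - L / 2 * t ^ 2 * ‖b - a‖ ^ 2)
      (⟪g (a + t • (b - a)), b - a⟫ - ⟪g a, b - a⟫ - L * t * ‖b - a‖ ^ 2) t := by
    intro t
    have h1 : HasDerivAt (fun t : ℝ => a + t • (b - a)) (b - a) t := by
      simpa using ((hasDerivAt_id t).smul_const (b - a)).const_add a
    have h2 := (hg (a + t • (b - a))).hasFDerivAt.comp_hasDerivAt t h1
    have h3 := (h2.sub ((hasDerivAt_id t).mul_const ⟪g a, b - a⟫)).sub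
      (((hasDerivAt_pow 2 t).const_mul (L / 2)).mul_const (‖b - a‖ ^ 2))
    refine h3.congr_deriv ?_
    simp only [InnerProductSpace.toDual_apply_apply]
    ring
  have hanti : AntitoneOn (fun t : ℝ => f (a + t • (b - a)) - t * ⟪g a, b - a⟫
      - L / 2 * t ^ 2 * ‖b - a‖ ^ 2) (Set.Icc 0 1) := by
    apply antitoneOn_of_deriv_nonpos (convex_Icc 0 1)
    · exact fun t _ => (hder t).continuousAt.continuousWithinAt
    · exact fun t _ => (hder t).differentiableAt.differentiableWithinAt
    · intro t ht
      rw [interior_Icc] at ht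
      rw [(hder t).deriv]
      have hm : a + t • (b - a) ∈ D := hD.add_smul_sub_mem ha hb ⟨ht.1.le, ht.2.le⟩
      have h1 := hs _ hm
      have h2 := real_inner_le_norm (g (a + t • (b - a)) - g a) (b - a)
      rw [inner_sub_left, norm_sub_rev] at h2
      have h3 : ‖a - (a + t • (b - a))‖ = t * ‖b - a‖ := by
        rw [sub_add_cancel_left, norm_neg, norm_smul, Real.norm_of_nonneg ht.1.le]
      rw [h3] at h1
      have := mul_le_mul_of_nonneg_right h1 (norm_nonneg (b - a))
      nlinarith
  have := hanti (Set.left_mem_Icc.2 zero_le_one) (Set.right_mem_Icc.2 zero_le_one) zero_le_one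
  simp at this
  linarith

theorem aux_step {E : Type*} [NormedAddCommGroup E] [InnerProductSpace ℝ E] [CompleteSpace E]
    {f : E → ℝ} {g : E → E} {r : E → ℝ} {D : Set E} (hr : ConvexOn ℝ D r) {L α : ℝ}
    (hL : 0 < L) (hα : α = 1 / (4 * L))
    (hg : ∀ t, HasGradientAt f (g t) t) {a b y w : E} (ha : a ∈ D)
    (hs : ∀ t ∈ D, ‖g a - g t‖ ≤ L * ‖a - t‖)
    (hb : IsProxPt r D α (a - α • (g a + w)) b) (hy : IsProxPt r D α (a - α • g a) y) :
    α / 2 * ‖α⁻¹ • (a - y)‖ ^ 2 ≤ (f a + r a) - (f b + r b) + α / 2 * ‖w‖ ^ 2 := by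
  have hαp : 0 < α := by rw [hα]; positivity
  have hd := aux_descent_s6 hr.1 hg ha hb.1 hs
  have h1 := aux_prox_ineq hαp hr hb hy.1
  have h2 := aux_prox_ineq hαp hr hy ha
  have ex : ∀ z v : E, 1 / (2 * α) * ‖z - (a - α • v)‖ ^ 2
      = 1 / (2 * α) * ‖z - a‖ ^ 2 + ⟪v, z - a⟫ + α / 2 * ‖v‖ ^ 2 := by
    intro z v
    rw [show z - (a - α • v) = (z - a) + α • v by abel, norm_add_sq_real, inner_smul_right,
      norm_smul, Real.norm_of_nonneg hαp.le, real_inner_comm]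
    field_simp
  rw [ex, ex] at h1 h2
  simp only [sub_self, norm_zero, inner_zero_right] at h2
  have e3 : ⟪g a + w, y - a⟫ - ⟪g a + w, b - a⟫ = ⟪g a, y - a⟫ - ⟪g a, b - a⟫ + ⟪w, y - b⟫ := by
    simp only [inner_add_left, inner_sub_right]; ring
  have e4 : ⟪w, y - b⟫ ≤ 1 / (2 * α) * ‖y - b‖ ^ 2 + α / 2 * ‖w‖ ^ 2 := by
    have := sq_nonneg (‖y - b‖ - α * ‖w‖)
    have h5 := real_inner_le_norm w (y - b)
    have h6 : 0 ≤ 1 / (2 * α) * (‖y - b‖ - α * ‖w‖) ^ 2 := by positivity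
    have h7 : 1 / (2 * α) * (‖y - b‖ - α * ‖w‖) ^ 2
      = 1 / (2 * α) * ‖y - b‖ ^ 2 + α / 2 * ‖w‖ ^ 2 - ‖w‖ * ‖y - b‖ := by field_simp; ring
    linarith
  have e5 : α / 2 * ‖α⁻¹ • (a - y)‖ ^ 2 = 1 / (2 * α) * ‖y - a‖ ^ 2 := by
    rw [norm_smul, norm_inv, Real.norm_of_nonneg hαp.le, norm_sub_rev]; field_simp
  have e6 : ‖a - y‖ = ‖y - a‖ := norm_sub_rev _ _
  have e7 : 1 / (2 * α) = 2 * L := by rw [hα]; field_simp; norm_num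
  rw [e5]
  rw [e6] at h2
  rw [e7] at h1 h2 e4 ⊢
  have e8 : 0 ≤ L * ‖b - a‖ ^ 2 := by positivity
  nlinarith

theorem aux_meas {n : ℕ} {d : Fin n → ℕ} (f : (∀ i, EuclideanSpace ℝ (Fin (d i))) → ℝ)
    (hf : ∀ u i, Continuous fun t => f (Function.update u i t)) : Measurable f := by
  have key : ∀ s : Finset (Fin n), ∀ a : (∀ i, EuclideanSpace ℝ (Fin (d i))),
      Measurable fun u : (∀ i, EuclideanSpace ℝ (Fin (d i))) => f (s.piecewise u a) := by
    intro s
    induction s using Finset.induction_on with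
    | empty => intro a; simp
    | insert i s his ih =>
      intro a
      have h1 : Measurable (Function.uncurry
          fun (t : EuclideanSpace ℝ (Fin (d i))) (u : ∀ i, EuclideanSpace ℝ (Fin (d i))) =>
            f (Function.update (s.piecewise u a) i t)) := by
        apply measurable_uncurry_of_continuous_of_measurable
        · intro u; exact hf _ i
        · intro t
          convert ih (Function.update a i t) using 3 with u
          rw [Finset.update_piecewise_of_notMem _ _ _ his]
      have h0 : Measurable fun u : (∀ i, EuclideanSpace ℝ (Fin (d i))) => (u i, u) :=
        (measurable_pi_apply i).prodMk measurable_id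
      have h2 := h1.comp h0
      convert h2 using 2 with u
      simp [Function.comp, Function.uncurry, Finset.piecewise_insert]
  simpa using key Finset.univ (fun _ => 0)

theorem aux_grad_meas {n : ℕ} {d : Fin n → ℕ} (f : (∀ i, EuclideanSpace ℝ (Fin (d i))) → ℝ)
    (g : (∀ i, EuclideanSpace ℝ (Fin (d i))) → ∀ i, EuclideanSpace ℝ (Fin (d i)))
    (hg : ∀ (u : ∀ i, EuclideanSpace ℝ (Fin (d i))) (i : Fin n),
      HasGradientAt (fun t => f (Function.update u i t)) (g u i) (u i)) (i : Fin n) :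
    Measurable fun u => g u i := by
  have hf : Measurable f := by
    apply aux_meas
    intro u i
    rw [continuous_iff_continuousAt]
    intro t
    have := (hg (Function.update u i t) i).hasFDerivAt.continuousAt
    simpa using this
  have h1 : ∀ v : EuclideanSpace ℝ (Fin (d i)), Measurable fun u => ⟪v, g u i⟫ := by
    intro v
    have hm : ∀ m : ℕ, Measurable fun u : (∀ i, EuclideanSpace ℝ (Fin (d i))) =>
        ((m : ℝ) + 1) * (f (Function.update u i (u i + ((m : ℝ) + 1)⁻¹ • v)) - f u) := by
      intro m
      refine ((hf.comp ?_).sub hf).const_mul _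
      rw [measurable_pi_iff]
      intro j
      by_cases hj : j = i
      · subst hj
        simp only [Function.update_self]
        exact (measurable_pi_apply j).add_const _
      · simp only [Function.update_of_ne hj]
        exact measurable_pi_apply j
    refine measurable_of_tendsto_metrizable hm ?_
    rw [tendsto_pi_nhds]
    intro u
    have h2 : HasDerivAt (fun t : ℝ => f (Function.update u i (u i + t • v))) ⟪v, g u i⟫ 0 := by
      have h3 : HasDerivAt (fun t : ℝ => u i + t • v) v 0 := by
        simpa using ((hasDerivAt_id (0:ℝ)).smul_const v).const_add (u i)
      have h4 : HasFDerivAt (fun t => f (Function.update u i t))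
        (InnerProductSpace.toDual ℝ _ (g u i)) (u i + (0:ℝ) • v) := by
        simpa using (hg u i).hasFDerivAt
      have := h4.comp_hasDerivAt (0:ℝ) h3
      refine this.congr_deriv ?_
      simp [real_inner_comm]
    have h5 := h2.tendsto_slope_zero_right
    have h6 : Filter.Tendsto (fun m : ℕ => ((m : ℝ) + 1)⁻¹) Filter.atTop
        (nhdsWithin 0 (Set.Ioi 0)) := by
      rw [tendsto_nhdsWithin_iff]
      refine ⟨?_, Filter.Eventually.of_forall fun m => by
        simp only [Set.mem_Ioi]; positivity⟩
      simpa using tendsto_one_div_add_atTop_nhds_zero_nat (𝕜 := ℝ)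
    have h7 := h5.comp h6
    simpa [Function.comp_def] using h7
  have h2 : (fun u => g u i) = fun u =>
      ∑ j, ⟪EuclideanSpace.basisFun (Fin (d i)) ℝ j, g u i⟫ •
        EuclideanSpace.basisFun (Fin (d i)) ℝ j := by
    funext u
    exact ((EuclideanSpace.basisFun (Fin (d i)) ℝ).sum_repr' (g u i)).symm
  rw [h2]
  exact Finset.measurable_sum _ fun j _ => (h1 _).smul_const _

theorem aux_indep {Ω : Type*} {m mΩ : MeasurableSpace Ω} {μ : Measure Ω} [IsProbabilityMeasure μ]
    (hm : m ≤ mΩ) {n : ℕ} {X : Ω → Fin n} (hX : Measurable X)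
    (h : Indep (MeasurableSpace.comap X inferInstance) m μ) {f : Ω → ℝ}
    (hf : Measurable[m] f) (hfi : Integrable f μ) (i : Fin n) :
    ∫ ω in {ω | X ω = i}, f ω ∂μ = μ.real {ω | X ω = i} * ∫ ω, f ω ∂μ := by
  have h1 := condExp_indep_eq hm hX.comap_le (f := f) hf.stronglyMeasurable h.symm
  have hs : MeasurableSet[MeasurableSpace.comap X inferInstance] {ω | X ω = i} :=
    ⟨{i}, measurableSet_singleton i, rfl⟩
  rw [← setIntegral_condExp hX.comap_le hfi hs]
  rw [setIntegral_congr_ae (g := fun _ => ∫ ω, f ω ∂μ) (hX.comap_le _ hs)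
    (h1.mono fun ω hω _ => hω)]
  simp

theorem aux_count {n : ℕ} (s : ℕ → Fin n) (i : Fin n) (K : ℕ) :
    ∑ k ∈ Finset.range K, (if s k = i then
      (1 : ℝ) / (((((Finset.range k).filter fun q => s q = i).card + 1) *
        (((Finset.range k).filter fun q => s q = i).card + 2) : ℕ) : ℝ) else 0)
      = 1 - 1 / ((((Finset.range K).filter fun q => s q = i).card : ℝ) + 1) := by
  induction K with
  | zero => simp
  | succ K ih =>
    rw [Finset.sum_range_succ, ih, Finset.range_add_one, Finset.filter_insert]
    split_ifs with h
    · rw [Finset.card_insert_of_notMem (by simp)]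
      push_cast
      field_simp
      ring
    · simp

/-- Quadratic batch-size policy (Proposition 1 of the paper): with `p_i = 1/n`,
`α_i = 1/(4L_i)` and `N_i(k) = (Γ_i(k)+1)(Γ_i(k)+2)`, the ergodic mean-squared gradient
mapping is bounded by
`(16 n L_max (E[F(x(0))] - F*) + 2 n² σ² L_max ∑_i L_i⁻¹)/(K+1)`; consequently the
iteration complexity for an `ε`-stationary point is `O(1/ε)` and the expected number of
sampled gradients is `O(1/ε³)`. -/
theorem stmt6
    {n : ℕ} {d : Fin n → ℕ}
    {Ω : Type*} {mΩ : MeasurableSpace Ω} {μ : Measure Ω} [IsProbabilityMeasure μ]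
    (ℱ : Filtration ℕ mΩ)
    (fbar : (∀ i, EuclideanSpace ℝ (Fin (d i))) → ℝ)
    (gradf : (∀ i, EuclideanSpace ℝ (Fin (d i))) → ∀ i, EuclideanSpace ℝ (Fin (d i)))
    (r : ∀ i, EuclideanSpace ℝ (Fin (d i)) → ℝ)
    (D : ∀ i, Set (EuclideanSpace ℝ (Fin (d i))))
    (L α p : Fin n → ℝ) (σ : ℝ) (hσ : 0 < σ) (Fstar : ℝ)
    (x : ℕ → Ω → ∀ i, EuclideanSpace ℝ (Fin (d i)))
    (w : ∀ i : Fin n, ℕ → Ω → EuclideanSpace ℝ (Fin (d i)))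
    (idx : ℕ → Ω → Fin n)
    (N : Fin n → ℕ → Ω → ℕ)
    -- the regularizers: proper lsc convex with compact effective domain
    (hDconv : ∀ i, Convex ℝ (D i)) (hDcomp : ∀ i, IsCompact (D i))
    (hDne : ∀ i, (D i).Nonempty)
    (hrconv : ∀ i, ConvexOn ℝ (D i) (r i))
    (hrlsc : ∀ i, LowerSemicontinuousOn (r i) (D i))
    -- `gradf u i` is the block partial gradient `∇_{x_i} f̄(u)`
    (hgrad : ∀ (u : ∀ i, EuclideanSpace ℝ (Fin (d i))) (i : Fin n),
      HasGradientAt (fun t => fbar (Function.update u i t)) (gradf u i) (u i))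
    (hLpos : ∀ i, 0 < L i)
    -- blockwise `L_i`-smoothness of `f̄`
    (hsmooth : ∀ (u : ∀ i, EuclideanSpace ℝ (Fin (d i))), (∀ j, u j ∈ D j) →
      ∀ i, ∀ ui' ∈ D i, ‖gradf u i - gradf (Function.update u i ui') i‖ ≤ L i * ‖u i - ui'‖)
    -- `F` attains its minimum value `F*` on the effective domain
    (hFstar : IsLeast ((fun u => fbar u + ∑ i, r i (u i)) '' {u | ∀ j, u j ∈ D j}) Fstar)
    (hp : ∀ i, 0 < p i ∧ p i < 1) (hpsum : ∑ i, p i = 1)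
    (hαpos : ∀ i, 0 < α i)
    -- the iterates stay in the effective domain and are adapted
    (hxdom : ∀ k ω i, x k ω i ∈ D i)
    (hadapt : ∀ k, StronglyMeasurable[ℱ k] (x k))
    -- block selection: `P(i_k = i) = p_i`, independent of `ℱ_k`
    (hidxmeas : ∀ k, Measurable (idx k))
    (hidxdist : ∀ k i, μ {ω | idx k ω = i} = ENNReal.ofReal (p i))
    (hidxindep : ∀ k, Indep (MeasurableSpace.comap (idx k) inferInstance) (ℱ k) μ)
    -- batch sizes: positive and adapted
    (hNpos : ∀ i k ω, 0 < N i k ω)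
    (hNadapt : ∀ i k, Measurable[ℱ k] (N i k))
    -- noise: `E[‖w_i(k+1)‖² | ℱ_k] ≤ σ²/N_i(k)` a.s.
    (hnoise : ∀ (i : Fin n) (k : ℕ), ∀ᵐ ω ∂μ,
      (μ[fun ω' => ‖w i (k + 1) ω'‖ ^ 2|ℱ k]) ω ≤ σ ^ 2 / (N i k ω : ℝ))
    (hwint : ∀ (i : Fin n) (k : ℕ), Integrable (fun ω => ‖w i (k + 1) ω‖ ^ 2) μ)
    -- the update: chosen block does a proximal stochastic-gradient step, others stay put
    (hupdate : ∀ (k : ℕ) (ω : Ω),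
      IsProxPt (r (idx k ω)) (D (idx k ω)) (α (idx k ω))
          (x k ω (idx k ω) -
            α (idx k ω) • (gradf (x k ω) (idx k ω) + w (idx k ω) (k + 1) ω))
          (x (k + 1) ω (idx k ω)) ∧
        ∀ j, j ≠ idx k ω → x (k + 1) ω j = x k ω j)
    (hFint : ∀ k, Integrable (fun ω => fbar (x k ω) + ∑ i, r i (x k ω i)) μ)
    (Lmax : ℝ) (hLmax : IsGreatest (Set.range L) Lmax)
    -- `prox i u = prox_{α_i r_i}(u)`
    (prox : ∀ i : Fin n, EuclideanSpace ℝ (Fin (d i)) → EuclideanSpace ℝ (Fin (d i)))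
    (hprox : ∀ i u, IsProxPt (r i) (D i) (α i) u (prox i u))
    (hGint : ∀ k, Integrable (fun ω =>
      ∑ i, ‖(α i)⁻¹ • (x k ω i - prox i (x k ω i - α i • gradf (x k ω) i))‖ ^ 2) μ)
    -- parameter choices: uniform selection, `α_i = 1/(4 L_i)`,
    -- `N_i(k) = (Γ_i(k)+1)(Γ_i(k)+2)` where `Γ_i(k)` counts prior selections of block `i`
    (hpunif : ∀ i, p i = 1 / n) (hα : ∀ i, α i = 1 / (4 * L i))
    (hN : ∀ i k ω, N i k ω =
      (((Finset.range k).filter fun p' => idx p' ω = i).card + 1) *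
        (((Finset.range k).filter fun p' => idx p' ω = i).card + 2)) :
    (∀ K : ℕ,
      1 / ((K : ℝ) + 1) * ∑ k ∈ Finset.range (K + 1), ∫ ω,
          (∑ i, ‖(α i)⁻¹ • (x k ω i - prox i (x k ω i - α i • gradf (x k ω) i))‖ ^ 2) ∂μ ≤
        16 * n * Lmax * ((∫ ω, (fbar (x 0 ω) + ∑ i, r i (x 0 ω i)) ∂μ) - Fstar) /
            ((K : ℝ) + 1) +
          2 * n ^ 2 * σ ^ 2 * Lmax * (∑ i, (L i)⁻¹) / ((K : ℝ) + 1)) ∧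
    ∃ C : ℝ, 0 < C ∧ ∀ ε : ℝ, 0 < ε → ε ≤ 1 → ∃ K : ℕ,
      (K : ℝ) + 1 ≤ C / ε ∧
      1 / ((K : ℝ) + 1) * ∑ k ∈ Finset.range (K + 1), ∫ ω,
          (∑ i, ‖(α i)⁻¹ • (x k ω i - prox i (x k ω i - α i • gradf (x k ω) i))‖ ^ 2) ∂μ ≤
        ε ∧
      ∫ ω, (∑ k ∈ Finset.range K, ∑ i,
          if idx k ω = i then (N i k ω : ℝ) else 0) ∂μ ≤ C / ε ^ 3 := by
  have hn1 : 0 < n := by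
    rcases Nat.eq_zero_or_pos n with h | h
    · subst h; simp at hpsum
    · exact h
  have hnR : (0 : ℝ) < n := by exact_mod_cast hn1
  have hLmaxpos : 0 < Lmax := by
    obtain ⟨i, hi⟩ := hLmax.1
    rw [← hi]; exact hLpos i
  have hLle : ∀ i, L i ≤ Lmax := fun i => hLmax.2 ⟨i, rfl⟩
  -- measurability of the gradient mapping
  have hGm : ∀ k i, Measurable[ℱ k] fun ω =>
      ‖(α i)⁻¹ • (x k ω i - prox i (x k ω i - α i • gradf (x k ω) i))‖ ^ 2 := by
    intro k i
    have hg := aux_grad_meas fbar gradf hgrad i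
    have hpr := (aux_prox_cont (hαpos i) (hrconv i) (hprox i)).measurable
    have h1 : Measurable fun u : (∀ i, EuclideanSpace ℝ (Fin (d i))) =>
        ‖(α i)⁻¹ • (u i - prox i (u i - α i • gradf u i))‖ ^ 2 := by
      have h0 : Measurable fun u : (∀ i, EuclideanSpace ℝ (Fin (d i))) => u i :=
        measurable_pi_apply i
      exact (((h0.sub (hpr.comp (h0.sub (hg.const_smul (α i))))).const_smul
        (α i)⁻¹).norm).pow_const 2
    exact h1.comp (hadapt k).measurable
  have hGi : ∀ k i, Integrable (fun ω =>
      ‖(α i)⁻¹ • (x k ω i - prox i (x k ω i - α i • gradf (x k ω) i))‖ ^ 2) μ := by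
    intro k i
    refine (hGint k).mono' ((hGm k i).mono (ℱ.le k) le_rfl).aestronglyMeasurable ?_
    refine Filter.Eventually.of_forall fun ω => ?_
    rw [Real.norm_of_nonneg (by positivity)]
    exact Finset.single_le_sum (f := fun i =>
      ‖(α i)⁻¹ • (x k ω i - prox i (x k ω i - α i • gradf (x k ω) i))‖ ^ 2)
      (fun j _ => by positivity) (Finset.mem_univ i)
  have hset : ∀ k i, MeasurableSet {ω | idx k ω = i} := fun k i =>
    hidxmeas k (measurableSet_singleton i)
  have hreal : ∀ k i, μ.real {ω | idx k ω = i} = 1 / n := by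
    intro k i
    rw [measureReal_def, hidxdist k i, hpunif i, ENNReal.toReal_ofReal (by positivity)]
  -- pointwise descent
  have hpt : ∀ k ω, (∑ i, Set.indicator {ω | idx k ω = i} (fun ω => α i / 2 *
        ‖(α i)⁻¹ • (x k ω i - prox i (x k ω i - α i • gradf (x k ω) i))‖ ^ 2) ω) ≤
      (fbar (x k ω) + ∑ i, r i (x k ω i)) - (fbar (x (k + 1) ω) + ∑ i, r i (x (k + 1) ω i))
        + ∑ i, α i / 2 * ‖w i (k + 1) ω‖ ^ 2 := by
    intro k ω
    obtain ⟨hu1, hu2⟩ := hupdate k ω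
    have hl : (∑ i, Set.indicator {ω | idx k ω = i} (fun ω => α i / 2 *
        ‖(α i)⁻¹ • (x k ω i - prox i (x k ω i - α i • gradf (x k ω) i))‖ ^ 2) ω)
        = α (idx k ω) / 2 * ‖(α (idx k ω))⁻¹ • (x k ω (idx k ω) - prox (idx k ω)
          (x k ω (idx k ω) - α (idx k ω) • gradf (x k ω) (idx k ω)))‖ ^ 2 := by
      rw [Finset.sum_eq_single (idx k ω)]
      · rw [Set.indicator_of_mem]; rfl
      · intro j _ hj
        rw [Set.indicator_of_notMem]
        exact fun h => hj h.symm
      · simp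
    rw [hl]
    have hwl : α (idx k ω) / 2 * ‖w (idx k ω) (k + 1) ω‖ ^ 2
        ≤ ∑ i, α i / 2 * ‖w i (k + 1) ω‖ ^ 2 :=
      Finset.single_le_sum (f := fun i => α i / 2 * ‖w i (k + 1) ω‖ ^ 2)
        (fun j _ => by have := hαpos j; positivity) (Finset.mem_univ _)
    generalize idx k ω = i at hu1 hu2 hwl ⊢
    have hup : x (k + 1) ω = Function.update (x k ω) i (x (k + 1) ω i) := by
      funext j
      by_cases hj : j = i
      · subst hj; simp
      · rw [Function.update_of_ne hj, hu2 j hj]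
    have hst := aux_step (f := fun t => fbar (Function.update (x k ω) i t))
      (g := fun t => gradf (Function.update (x k ω) i t) i) (hrconv i) (hLpos i) (hα i)
      (a := x k ω i) (b := x (k + 1) ω i) (w := w i (k + 1) ω)
      (y := prox i (x k ω i - α i • gradf (x k ω) i))
      (by
        intro t
        have := hgrad (Function.update (x k ω) i t) i
        simpa using this)
      (hxdom k ω i)
      (by
        intro t ht
        simpa using hsmooth (x k ω) (hxdom k ω) i t ht)
      (by simpa using hu1)
      (by simpa using hprox i (x k ω i - α i • gradf (x k ω) i))
    simp only [Function.update_eq_self] at hst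
    rw [← hup] at hst
    have hs1 := Finset.add_sum_erase Finset.univ (fun j => r j (x k ω j)) (Finset.mem_univ i)
    have hs2 := Finset.add_sum_erase Finset.univ (fun j => r j (x (k + 1) ω j))
      (Finset.mem_univ i)
    have hs3 : ∑ j ∈ Finset.univ.erase i, r j (x (k + 1) ω j)
        = ∑ j ∈ Finset.univ.erase i, r j (x k ω j) := by
      refine Finset.sum_congr rfl fun j hj => ?_
      rw [hu2 j (Finset.ne_of_mem_erase hj)]
    rw [← hs1, ← hs2, hs3]
    linarith
  -- noise
  have hNm : ∀ i k, Measurable[ℱ k] fun ω => 1 / (N i k ω : ℝ) := by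
    intro i k
    have h1 : Measurable fun m : ℕ => 1 / (m : ℝ) := measurable_from_top
    exact h1.comp (hNadapt i k)
  have hNi : ∀ i k, Integrable (fun ω => 1 / (N i k ω : ℝ)) μ := by
    intro i k
    refine (integrable_const (1 : ℝ)).mono'
      ((hNm i k).mono (ℱ.le k) le_rfl).aestronglyMeasurable ?_
    refine Filter.Eventually.of_forall fun ω => ?_
    rw [Real.norm_of_nonneg (by positivity)]
    have h1 : (1 : ℝ) ≤ N i k ω := by exact_mod_cast hNpos i k ω
    rw [div_le_one (by linarith)]
    exact h1
  have hw : ∀ i k, ∫ ω, ‖w i (k + 1) ω‖ ^ 2 ∂μ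
      ≤ σ ^ 2 * (n * ∫ ω in {ω | idx k ω = i}, 1 / (N i k ω : ℝ) ∂μ) := by
    intro i k
    rw [aux_indep (ℱ.le k) (hidxmeas k) (hidxindep k) (hNm i k) (hNi i k) i, hreal,
      ← integral_condExp (ℱ.le k)]
    have h1 : ∫ ω, (μ[fun ω' => ‖w i (k + 1) ω'‖ ^ 2|ℱ k]) ω ∂μ
        ≤ ∫ ω, σ ^ 2 * (1 / (N i k ω : ℝ)) ∂μ := by
      refine integral_mono_ae integrable_condExp ((hNi i k).const_mul _) ?_
      filter_upwards [hnoise i k] with ω hω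
      rw [mul_one_div]; exact hω
    rw [integral_const_mul] at h1
    refine h1.trans (le_of_eq ?_)
    field_simp
  have hNsum : ∀ i K, ∑ k ∈ Finset.range K, ∫ ω in {ω | idx k ω = i}, 1 / (N i k ω : ℝ) ∂μ
      ≤ 1 := by
    intro i K
    have h1 : ∀ k, ∫ ω in {ω | idx k ω = i}, 1 / (N i k ω : ℝ) ∂μ
        = ∫ ω, Set.indicator {ω | idx k ω = i} (fun ω => 1 / (N i k ω : ℝ)) ω ∂μ :=
      fun k => (integral_indicator (hset k i)).symm
    simp_rw [h1]
    rw [← integral_finsetSum _ fun k _ => (hNi i k).indicator (hset k i)]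
    have h2 : ∫ ω, ∑ k ∈ Finset.range K,
        Set.indicator {ω | idx k ω = i} (fun ω => 1 / (N i k ω : ℝ)) ω ∂μ ≤ ∫ ω, (1 : ℝ) ∂μ := by
      refine integral_mono (integrable_finsetSum _ fun k _ =>
        (hNi i k).indicator (hset k i)) (integrable_const _) fun ω => ?_
      have h3 := aux_count (fun k => idx k ω) i K
      have h4 : ∑ k ∈ Finset.range K,
          Set.indicator {ω | idx k ω = i} (fun ω => 1 / (N i k ω : ℝ)) ω
          = 1 - 1 / ((((Finset.range K).filter fun q => idx q ω = i).card : ℝ) + 1) := by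
        rw [← h3]
        refine Finset.sum_congr rfl fun k _ => ?_
        rw [Set.indicator_apply, ← hN i k ω]
        rfl
      show ∑ k ∈ Finset.range K,
          Set.indicator {ω | idx k ω = i} (fun ω => 1 / (N i k ω : ℝ)) ω ≤ 1
      rw [h4]
      have : (0 : ℝ) ≤ 1 / ((((Finset.range K).filter fun q => idx q ω = i).card : ℝ) + 1) := by
        positivity
      linarith
    simpa using h2
  -- one step in expectation
  have hexp : ∀ k, 1 / (8 * n * Lmax) * ∫ ω,
      (∑ i, ‖(α i)⁻¹ • (x k ω i - prox i (x k ω i - α i • gradf (x k ω) i))‖ ^ 2) ∂μ ≤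
      (∫ ω, (fbar (x k ω) + ∑ i, r i (x k ω i)) ∂μ)
        - (∫ ω, (fbar (x (k + 1) ω) + ∑ i, r i (x (k + 1) ω i)) ∂μ)
        + ∑ i, α i / 2 * (σ ^ 2 * (n * ∫ ω in {ω | idx k ω = i}, 1 / (N i k ω : ℝ) ∂μ)) := by
    intro k
    have hII : ∀ i, Integrable (Set.indicator {ω | idx k ω = i} (fun ω => α i / 2 *
        ‖(α i)⁻¹ • (x k ω i - prox i (x k ω i - α i • gradf (x k ω) i))‖ ^ 2)) μ :=
      fun i => ((hGi k i).const_mul _).indicator (hset k i)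
    have hWI : ∀ i, Integrable (fun ω => α i / 2 * ‖w i (k + 1) ω‖ ^ 2) μ :=
      fun i => (hwint i k).const_mul _
    have hF2 := (hFint k).sub (hFint (k + 1))
    have hWS := integrable_finsetSum Finset.univ fun i _ => hWI i
    have h1 := integral_mono (μ := μ) (integrable_finsetSum Finset.univ fun i _ => hII i)
      (hF2.add hWS) (hpt k)
    rw [integral_finsetSum _ fun i _ => hII i] at h1
    have h2 : ∫ ω, ((fbar (x k ω) + ∑ i, r i (x k ω i))
        - (fbar (x (k + 1) ω) + ∑ i, r i (x (k + 1) ω i))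
        + ∑ i, α i / 2 * ‖w i (k + 1) ω‖ ^ 2) ∂μ
        = (∫ ω, (fbar (x k ω) + ∑ i, r i (x k ω i)) ∂μ)
        - (∫ ω, (fbar (x (k + 1) ω) + ∑ i, r i (x (k + 1) ω i)) ∂μ)
        + ∑ i, α i / 2 * ∫ ω, ‖w i (k + 1) ω‖ ^ 2 ∂μ := by
      have e1 := integral_add (μ := μ) hF2 hWS
      have e2 := integral_sub (μ := μ) (hFint k) (hFint (k + 1))
      have e3 := integral_finsetSum (μ := μ) Finset.univ fun i _ => hWI i
      simp only [integral_const_mul] at e3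
      rw [← e2, ← e3]
      exact e1
    have h1' := h1.trans (le_of_eq h2)
    have h3 : ∀ i, ∫ ω, Set.indicator {ω | idx k ω = i} (fun ω => α i / 2 *
        ‖(α i)⁻¹ • (x k ω i - prox i (x k ω i - α i • gradf (x k ω) i))‖ ^ 2) ω ∂μ
        = α i / 2 * (1 / n * ∫ ω,
        ‖(α i)⁻¹ • (x k ω i - prox i (x k ω i - α i • gradf (x k ω) i))‖ ^ 2 ∂μ) := by
      intro i
      rw [integral_indicator (hset k i), integral_const_mul,
        aux_indep (ℱ.le k) (hidxmeas k) (hidxindep k) (hGm k i) (hGi k i) i, hreal]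
    have h4 : 1 / (8 * n * Lmax) * ∫ ω,
        (∑ i, ‖(α i)⁻¹ • (x k ω i - prox i (x k ω i - α i • gradf (x k ω) i))‖ ^ 2) ∂μ
        ≤ ∑ i, ∫ ω, Set.indicator {ω | idx k ω = i} (fun ω => α i / 2 *
        ‖(α i)⁻¹ • (x k ω i - prox i (x k ω i - α i • gradf (x k ω) i))‖ ^ 2) ω ∂μ := by
      rw [integral_finsetSum _ fun i _ => hGi k i, Finset.mul_sum]
      refine Finset.sum_le_sum fun i _ => ?_
      rw [h3 i, ← mul_assoc]
      refine mul_le_mul_of_nonneg_right ?_ (integral_nonneg fun ω => by positivity)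
      rw [hα i]
      have hLi := hLpos i
      have e1 : 1 / (4 * L i) / 2 * (1 / (n : ℝ)) = 1 / (8 * n * L i) := by
        field_simp; norm_num
      rw [e1]
      exact one_div_le_one_div_of_le (by positivity)
        (mul_le_mul_of_nonneg_left (hLle i) (by positivity))
    have h5 : ∑ i, α i / 2 * ∫ ω, ‖w i (k + 1) ω‖ ^ 2 ∂μ
        ≤ ∑ i, α i / 2 * (σ ^ 2 * (n * ∫ ω in {ω | idx k ω = i}, 1 / (N i k ω : ℝ) ∂μ)) := by
      refine Finset.sum_le_sum fun i _ => ?_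
      exact mul_le_mul_of_nonneg_left (hw i k) (by have := hαpos i; positivity)
    linarith
  have hFge : ∀ k, Fstar ≤ ∫ ω, (fbar (x k ω) + ∑ i, r i (x k ω i)) ∂μ := by
    intro k
    have h1 : ∫ ω, Fstar ∂μ ≤ ∫ ω, (fbar (x k ω) + ∑ i, r i (x k ω i)) ∂μ := by
      refine integral_mono (integrable_const _) (hFint k) fun ω => ?_
      exact hFstar.2 ⟨x k ω, hxdom k ω, rfl⟩
    simpa using h1
  have hS0 : 0 ≤ ∑ i, (L i)⁻¹ := Finset.sum_nonneg fun i _ => (inv_pos.2 (hLpos i)).le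
  have htot : ∀ K, ∑ k ∈ Finset.range K, ∫ ω,
      (∑ i, ‖(α i)⁻¹ • (x k ω i - prox i (x k ω i - α i • gradf (x k ω) i))‖ ^ 2) ∂μ ≤
      16 * n * Lmax * ((∫ ω, (fbar (x 0 ω) + ∑ i, r i (x 0 ω i)) ∂μ) - Fstar) +
          2 * n ^ 2 * σ ^ 2 * Lmax * (∑ i, (L i)⁻¹) := by
    intro K
    have h1 := Finset.sum_le_sum fun k (_ : k ∈ Finset.range K) => hexp k
    rw [← Finset.mul_sum, Finset.sum_add_distrib, Finset.sum_range_sub', Finset.sum_comm] at h1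
    have h2 : ∑ i, ∑ k ∈ Finset.range K,
        α i / 2 * (σ ^ 2 * (n * ∫ ω in {ω | idx k ω = i}, 1 / (N i k ω : ℝ) ∂μ))
        ≤ ∑ i, (n * σ ^ 2 / 8) * (L i)⁻¹ := by
      refine Finset.sum_le_sum fun i _ => ?_
      rw [← Finset.mul_sum, ← Finset.mul_sum, ← Finset.mul_sum]
      have hLi := hLpos i
      have e1 : (n * σ ^ 2 / 8) * (L i)⁻¹ = α i / 2 * (σ ^ 2 * (n * 1)) := by
        rw [hα i]; field_simp; norm_num
      rw [e1]
      have := hNsum i K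
      have := hαpos i
      gcongr
    rw [← Finset.mul_sum] at h2
    have h3 := hFge K
    have h4 := hFge 0
    have h5 : 1 / (8 * n * Lmax) * ∑ k ∈ Finset.range K, ∫ ω,
        (∑ i, ‖(α i)⁻¹ • (x k ω i - prox i (x k ω i - α i • gradf (x k ω) i))‖ ^ 2) ∂μ
        ≤ ((∫ ω, (fbar (x 0 ω) + ∑ i, r i (x 0 ω i)) ∂μ) - Fstar)
          + n * σ ^ 2 / 8 * ∑ i, (L i)⁻¹ := by linarith
    rw [one_div_mul_eq_div, div_le_iff₀ (by positivity)] at h5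
    refine h5.trans ?_
    have h6 : 0 ≤ n * Lmax * ((∫ ω, (fbar (x 0 ω) + ∑ i, r i (x 0 ω i)) ∂μ) - Fstar) :=
      mul_nonneg (by positivity) (by linarith)
    have h7 : 0 ≤ (n : ℝ) ^ 2 * σ ^ 2 * Lmax * (∑ i, (L i)⁻¹) := by positivity
    nlinarith
  obtain ⟨B, hB⟩ : ∃ B, B = 16 * n * Lmax *
      ((∫ ω, (fbar (x 0 ω) + ∑ i, r i (x 0 ω i)) ∂μ) - Fstar) +
          2 * n ^ 2 * σ ^ 2 * Lmax * (∑ i, (L i)⁻¹) := ⟨_, rfl⟩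
  have hB0 : 0 ≤ B := by
    have := htot 0
    rw [← hB, Finset.sum_range_zero] at this
    exact this
  have havg : ∀ K : ℕ, 1 / ((K : ℝ) + 1) * ∑ k ∈ Finset.range (K + 1), ∫ ω,
      (∑ i, ‖(α i)⁻¹ • (x k ω i - prox i (x k ω i - α i • gradf (x k ω) i))‖ ^ 2) ∂μ
      ≤ B / ((K : ℝ) + 1) := by
    intro K
    rw [one_div_mul_eq_div]
    have := htot (K + 1)
    rw [← hB] at this
    gcongr
  refine ⟨?_, ?_⟩
  · intro K
    have := havg K
    rw [hB, add_div] at this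
    exact this
  · refine ⟨(B + 2) ^ 3, by positivity, ?_⟩
    intro ε hε hε1
    have hKle : ((⌈B / ε⌉₊ : ℕ) : ℝ) + 1 ≤ (B + 2) / ε := by
      have h1 := Nat.ceil_lt_add_one (show 0 ≤ B / ε by positivity)
      have h2 : 1 ≤ 1 / ε := by rw [le_div_iff₀ hε]; linarith
      have h3 : (B + 2) / ε = B / ε + 2 * (1 / ε) := by ring
      rw [h3]; linarith
    have hKge : B / ε ≤ ((⌈B / ε⌉₊ : ℕ) : ℝ) := Nat.le_ceil _
    generalize ⌈B / ε⌉₊ = K at hKle hKge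
    refine ⟨K, ?_, ?_, ?_⟩
    · refine hKle.trans ?_
      have : B + 2 ≤ (B + 2) ^ 3 := by
        have := pow_le_pow_right₀ (show 1 ≤ B + 2 by linarith) (show 1 ≤ 3 by norm_num)
        simpa using this
      gcongr
    · refine (havg K).trans ?_
      rw [div_le_iff₀ (by positivity)]
      rw [div_le_iff₀ hε] at hKge
      nlinarith
    · have h1 : ∫ ω, (∑ k ∈ Finset.range K, ∑ i,
          if idx k ω = i then (N i k ω : ℝ) else 0) ∂μ ≤ ∫ ω, ((K : ℝ) + 1) ^ 3 ∂μ := by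
        refine integral_mono_of_nonneg (Filter.Eventually.of_forall fun ω => ?_)
          (integrable_const _) (Filter.Eventually.of_forall fun ω => ?_)
        · exact Finset.sum_nonneg fun k _ => Finset.sum_nonneg fun i _ => by
            split_ifs <;> positivity
        · have h2 : ∀ k ∈ Finset.range K, (∑ i, if idx k ω = i then (N i k ω : ℝ) else 0)
              ≤ ((K : ℝ) + 1) ^ 2 := by
            intro k hk
            rw [Finset.sum_ite_eq]
            simp only [Finset.mem_univ, if_true]
            rw [hN]
            have hc := Finset.card_filter_le (Finset.range k) (fun q => idx q ω = idx k ω)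
            rw [Finset.card_range] at hc
            have hk' := Finset.mem_range.1 hk
            have h3 : ((Finset.range k).filter fun q => idx q ω = idx k ω).card + 1 ≤ K := by
              omega
            have h4 : (((Finset.range k).filter fun q => idx q ω = idx k ω).card + 1) *
                (((Finset.range k).filter fun q => idx q ω = idx k ω).card + 2)
                ≤ (K + 1) ^ 2 := by
              rw [pow_two]
              exact Nat.mul_le_mul (by omega) (by omega)
            exact_mod_cast h4
          refine (Finset.sum_le_sum h2).trans ?_
          rw [Finset.sum_const, Finset.card_range, nsmul_eq_mul]
          have : (0 : ℝ) ≤ ((K : ℝ) + 1) ^ 2 := by positivity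
          nlinarith
      have h2 : ∫ ω, ((K : ℝ) + 1) ^ 3 ∂μ = ((K : ℝ) + 1) ^ 3 := by simp
      rw [h2] at h1
      refine h1.trans ?_
      rw [← div_pow]
      gcongr

end
end

section
/- For every q ∈ (0,1), every real v > 0, and every integer k ≥ 0: Σ_{m=1}^{k+1} q^{k+1−m} m^{−v} ≤ q^{k+1} ( e^{2v} q^{−1} − 1 )/(1 − q) + 2 (k+1)^{−v} / ( q ln(1/q) ). -/
open Real Finset

lemma aux_rec (q v : ℝ) (k : ℕ) :
    ∑ m ∈ Finset.Icc 1 (k + 1 + 1), q ^ (k + 1 + 1 - m) * (m : ℝ) ^ (-v) =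
    q * (∑ m ∈ Finset.Icc 1 (k + 1), q ^ (k + 1 - m) * (m : ℝ) ^ (-v)) +
      ((k : ℝ) + 2) ^ (-v) := by
  rw [Finset.sum_Icc_succ_top (by omega), Finset.mul_sum]
  congr 1
  · apply Finset.sum_congr rfl
    intro m hm
    rw [Finset.mem_Icc] at hm
    rw [show k + 1 + 1 - m = (k + 1 - m) + 1 by omega, pow_succ]
    ring
  · simp only [Nat.sub_self, pow_zero, one_mul]
    congr 1
    push_cast
    ring

lemma aux_geom (q v : ℝ) (h0 : 0 < q) (h1 : q < 1) (hv : 0 < v) (k : ℕ) :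
    ∑ m ∈ Finset.Icc 1 (k + 1), q ^ (k + 1 - m) * (m : ℝ) ^ (-v) ≤
      (1 - q ^ (k + 1)) / (1 - q) := by
  have hq : 0 < 1 - q := by linarith
  induction k with
  | zero => simp [hq.ne']
  | succ k ih =>
    rw [aux_rec]
    have h2 : ((k : ℝ) + 2) ^ (-v) ≤ 1 :=
      Real.rpow_le_one_of_one_le_of_nonpos (by linarith [Nat.cast_nonneg (α := ℝ) k])
        (by linarith)
    have h3 := mul_le_mul_of_nonneg_left ih h0.le
    have h4 : q * ((1 - q ^ (k + 1)) / (1 - q)) + 1 = (1 - q ^ (k + 1 + 1)) / (1 - q) := by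
      field_simp
      ring
    linarith

lemma aux_small (q v : ℝ) (h0 : 0 < q) (h1 : q < 1) (hv : 0 < v) (k : ℕ)
    (hk : (k : ℝ) * Real.log (1 / q) ≤ 2 * v) :
    ∑ m ∈ Finset.Icc 1 (k + 1), q ^ (k + 1 - m) * (m : ℝ) ^ (-v) ≤
      q ^ (k + 1) * (Real.exp (2 * v) * q⁻¹ - 1) / (1 - q) +
        2 * ((k : ℝ) + 1) ^ (-v) / (q * Real.log (1 / q)) := by
  have hq : 0 < 1 - q := by linarith
  have hL : 0 < Real.log (1 / q) := Real.log_pos (by rw [lt_div_iff₀ h0]; linarith)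
  have hg := aux_geom q v h0 h1 hv k
  have hp : 0 ≤ 2 * ((k : ℝ) + 1) ^ (-v) / (q * Real.log (1 / q)) := by positivity
  have he : (1 / q) ^ k ≤ Real.exp (2 * v) := by
    rw [← Real.exp_log (show 0 < 1 / q by positivity), ← Real.exp_nat_mul]
    exact Real.exp_le_exp.mpr hk
  have hm : 1 ≤ q ^ k * Real.exp (2 * v) := by
    have := mul_le_mul_of_nonneg_left he (pow_pos h0 k).le
    rwa [← mul_pow, mul_one_div_cancel h0.ne', one_pow] at this
  have h5 : (1 - q ^ (k + 1)) / (1 - q) ≤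
      q ^ (k + 1) * (Real.exp (2 * v) * q⁻¹ - 1) / (1 - q) := by
    apply div_le_div_of_nonneg_right _ hq.le
    have : q ^ (k + 1) * (Real.exp (2 * v) * q⁻¹ - 1) =
      q ^ k * Real.exp (2 * v) - q ^ (k + 1) := by
      field_simp
      try ring
    linarith
  linarith

lemma aux_step_s10 (q v : ℝ) (h0 : 0 < q) (h1 : q < 1) (hv : 0 < v) (x : ℝ) (hx : 0 < x)
    (hk : 2 * v ≤ x * Real.log (1 / q)) :
    q * (2 * x ^ (-v) / (q * Real.log (1 / q))) + (x + 1) ^ (-v) ≤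
      2 * (x + 1) ^ (-v) / (q * Real.log (1 / q)) := by
  have hL : 0 < Real.log (1 / q) := Real.log_pos (by rw [lt_div_iff₀ h0]; linarith)
  have hE : 1 / q = Real.exp (Real.log (1 / q)) := (Real.exp_log (by positivity)).symm
  have hE2 : Real.exp (Real.log (1 / q)) =
      Real.exp (Real.log (1 / q) / 2) * Real.exp (Real.log (1 / q) / 2) := by
    rw [← Real.exp_add]; congr 1; ring
  set L := Real.log (1 / q) with hLdef
  have hy : 0 < (x + 1) ^ (-v) := by positivity
  have hr : x ^ (-v) ≤ Real.exp (L / 2) * (x + 1) ^ (-v) := by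
    rw [Real.rpow_def_of_pos hx, Real.rpow_def_of_pos (by linarith : 0 < x + 1), ← Real.exp_add]
    apply Real.exp_le_exp.mpr
    have h2 : Real.log (x + 1) - Real.log x ≤ 1 / x := by
      rw [← Real.log_div (by positivity) hx.ne']
      have := Real.log_le_sub_one_of_pos (show 0 < (x + 1) / x by positivity)
      have h3 : (x + 1) / x - 1 = 1 / x := by field_simp; ring
      linarith
    have h4 : v * (1 / x) ≤ L / 2 := by
      rw [mul_one_div, div_le_iff₀ hx]; linarith
    have := mul_le_mul_of_nonneg_left h2 hv.le
    linarith
  have ht : 1 + L / 2 ≤ Real.exp (L / 2) := by linarith [Real.add_one_le_exp (L / 2)]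
  have key : 2 * Real.exp (L / 2) + L ≤ 2 * (1 / q) := by
    rw [hE, hE2]
    nlinarith
  have e1 : q * (2 * x ^ (-v) / (q * L)) + (x + 1) ^ (-v)
      = (2 * x ^ (-v) + L * (x + 1) ^ (-v)) / L := by
    field_simp
  have e2 : 2 * (x + 1) ^ (-v) / (q * L) = (2 * (1 / q) * (x + 1) ^ (-v)) / L := by
    field_simp
  rw [e1, e2]
  apply div_le_div_of_nonneg_right _ hL.le
  have := mul_le_mul_of_nonneg_right key hy.le
  linarith

/-- Lemma (i) of Lei (2018) as used in the paper: for `q ∈ (0,1)`, `v > 0` and any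
integer `k ≥ 0`,
`∑_{m=1}^{k+1} q^{k+1-m} m^{-v} ≤ q^{k+1} (e^{2v} q⁻¹ - 1)/(1-q) + 2 (k+1)^{-v}/(q ln(1/q))`. -/
theorem stmt10 (q : ℝ) (hq : q ∈ Set.Ioo (0 : ℝ) 1) (v : ℝ) (hv : 0 < v) (k : ℕ) :
    ∑ m ∈ Finset.Icc 1 (k + 1), q ^ (k + 1 - m) * (m : ℝ) ^ (-v) ≤
      q ^ (k + 1) * (Real.exp (2 * v) * q⁻¹ - 1) / (1 - q) +
        2 * ((k : ℝ) + 1) ^ (-v) / (q * Real.log (1 / q)) := by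
  obtain ⟨h0, h1⟩ := hq
  induction k with
  | zero => exact aux_small q v h0 h1 hv 0 (by simp; linarith)
  | succ k ih =>
    rcases le_total (((k + 1 : ℕ) : ℝ) * Real.log (1 / q)) (2 * v) with h | h
    · exact aux_small q v h0 h1 hv (k + 1) h
    · rw [aux_rec]
      have hs := aux_step_s10 q v h0 h1 hv ((k + 1 : ℕ) : ℝ) (by positivity) h
      have h3 := mul_le_mul_of_nonneg_left ih h0.le
      have h4 : ((k + 1 : ℕ) : ℝ) + 1 = (k : ℝ) + 2 := by push_cast; ring
      have h5 : ((k + 1 : ℕ) : ℝ) = (k : ℝ) + 1 := by push_cast; ring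
      rw [h4] at hs ⊢
      rw [h5] at hs
      have h6 : q * (q ^ (k + 1) * (Real.exp (2 * v) * q⁻¹ - 1) / (1 - q)) =
        q ^ (k + 1 + 1) * (Real.exp (2 * v) * q⁻¹ - 1) / (1 - q) := by
        rw [pow_succ q (k + 1)]; ring
      rw [mul_add, h6] at h3
      linarith
end

section
/- Let Γ be a binomial random variable with parameters k ∈ ℕ and p ∈ (0,1), and let v be a positive integer. Then E[ ( ∏_{t=1}^v (Γ + t) )^{−1} ] ≤ p^{−v} ∏_{t=1}^v (k + t)^{−1} ≤ p^{−v} (k + 1)^{−v}. -/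
open MeasureTheory Finset

lemma aux_prod (x v : ℕ) :
    (∏ t ∈ Finset.Icc 1 v, ((x : ℝ) + t)) * (x.factorial : ℝ) = ((x + v).factorial : ℝ) := by
  induction v with
  | zero => simp
  | succ n ih =>
    rw [Finset.prod_Icc_succ_top (by omega), mul_right_comm, ih, ← add_assoc,
      Nat.factorial_succ]
    push_cast
    ring

lemma aux_pos (x v : ℕ) : 0 < ∏ t ∈ Finset.Icc 1 v, ((x : ℝ) + t) := by
  apply Finset.prod_pos
  intro t ht
  have : 1 ≤ t := (Finset.mem_Icc.1 ht).1
  have : (1 : ℝ) ≤ t := by exact_mod_cast this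
  positivity

lemma aux_choose (k m v : ℕ) (h : m ≤ k) :
    (k.choose m : ℝ) * (∏ t ∈ Finset.Icc 1 v, ((m : ℝ) + t))⁻¹ =
      ((k + v).choose (m + v) : ℝ) * (∏ t ∈ Finset.Icc 1 v, ((k : ℝ) + t))⁻¹ := by
  have h1 := aux_prod m v
  have h2 := aux_prod k v
  have p1 := aux_pos m v
  have p2 := aux_pos k v
  have f1 : (0 : ℝ) < m.factorial := by exact_mod_cast m.factorial_pos
  have f2 : (0 : ℝ) < k.factorial := by exact_mod_cast k.factorial_pos
  have f3 : (0 : ℝ) < (k - m).factorial := by exact_mod_cast (k - m).factorial_pos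
  rw [Nat.cast_choose ℝ h, Nat.cast_choose ℝ (show m + v ≤ k + v by omega),
    Nat.add_sub_add_right, ← h1, ← h2]
  field_simp

lemma aux_sum (k v : ℕ) (p : ℝ) (h0 : 0 < p) (h1 : p < 1) :
    ∑ m ∈ Finset.range (k + 1), ((k.choose m : ℝ) * p ^ m * (1 - p) ^ (k - m)) *
      (∏ t ∈ Finset.Icc 1 v, ((m : ℝ) + t))⁻¹ ≤
      p ^ (-(v : ℤ)) * ∏ t ∈ Finset.Icc 1 v, ((k : ℝ) + t)⁻¹ := by
  have hq : 0 < 1 - p := by linarith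
  have p2 := aux_pos k v
  have e : ∀ m ∈ Finset.range (k + 1), ((k.choose m : ℝ) * p ^ m * (1 - p) ^ (k - m)) *
      (∏ t ∈ Finset.Icc 1 v, ((m : ℝ) + t))⁻¹ =
      (p ^ (-(v : ℤ)) * (∏ t ∈ Finset.Icc 1 v, ((k : ℝ) + t))⁻¹) *
        (p ^ (v + m) * (1 - p) ^ (k + v - (v + m)) * ((k + v).choose (v + m) : ℝ)) := by
    intro m hm
    have hm' : m ≤ k := by simpa [Nat.lt_succ_iff] using hm
    have := aux_choose k m v hm'
    have e1 : k + v - (v + m) = k - m := by omega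
    rw [e1, add_comm v m, zpow_neg, zpow_natCast, pow_add]
    calc _ = ((k.choose m : ℝ) * (∏ t ∈ Finset.Icc 1 v, ((m : ℝ) + t))⁻¹) *
          (p ^ m * (1 - p) ^ (k - m)) := by ring
      _ = _ := by rw [this]; field_simp
  rw [Finset.sum_congr rfl e, ← Finset.mul_sum, Finset.prod_inv_distrib]
  apply mul_le_of_le_one_right
  · positivity
  · have hb := add_pow p (1 - p) (k + v)
    rw [add_sub_cancel, one_pow, show k + v + 1 = v + (k + 1) by ring,
      Finset.sum_range_add] at hb
    refine le_of_le_of_eq ?_ hb.symm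
    apply le_add_of_nonneg_left
    apply Finset.sum_nonneg
    intros
    positivity

lemma aux_int {Ω : Type*} [MeasurableSpace Ω] (μ : Measure Ω) [IsProbabilityMeasure μ]
    (k : ℕ) (Γ : Ω → ℕ) (hΓmeas : Measurable Γ) (hΓle : ∀ ω, Γ ω ≤ k) (f : ℕ → ℝ) :
    ∫ ω, f (Γ ω) ∂μ = ∑ m ∈ Finset.range (k + 1), μ.real {ω | Γ ω = m} * f m := by
  have hms : ∀ m, MeasurableSet {ω | Γ ω = m} := fun m => hΓmeas (measurableSet_singleton m)
  have e : ∀ ω, f (Γ ω) =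
      ∑ m ∈ Finset.range (k + 1), ({ω | Γ ω = m} : Set Ω).indicator (fun _ => f m) ω := by
    intro ω
    rw [Finset.sum_eq_single (Γ ω)]
    · simp
    · intro b _ hb
      simp [Ne.symm hb]
    · intro h
      exact absurd (Finset.mem_range.2 (Nat.lt_succ_of_le (hΓle ω))) h
  simp_rw [e]
  rw [integral_finsetSum]
  · apply Finset.sum_congr rfl
    intro m _
    rw [integral_indicator_const _ (hms m), smul_eq_mul]
  · intro m _
    exact (integrable_const _).indicator (hms m)


/-- If `Γ` is a binomial random variable with parameters `k` and `p ∈ (0,1)` and `v ≥ 1` is an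
integer, then `E[(∏_{t=1}^v (Γ+t))⁻¹] ≤ p^{-v} ∏_{t=1}^v (k+t)⁻¹ ≤ p^{-v} (k+1)^{-v}`. -/
theorem stmt17 {Ω : Type*} [MeasurableSpace Ω] (μ : Measure Ω) [IsProbabilityMeasure μ]
    (k : ℕ) (p : ℝ) (hp : p ∈ Set.Ioo (0 : ℝ) 1)
    (Γ : Ω → ℕ) (hΓmeas : Measurable Γ) (hΓle : ∀ ω, Γ ω ≤ k)
    (hΓ : ∀ m : ℕ, μ {ω | Γ ω = m} =
      ENNReal.ofReal ((k.choose m : ℝ) * p ^ m * (1 - p) ^ (k - m)))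
    (v : ℕ) (hv : 1 ≤ v) :
    (∫ ω, (∏ t ∈ Finset.Icc 1 v, ((Γ ω : ℝ) + t))⁻¹ ∂μ) ≤
        p ^ (-(v : ℤ)) * ∏ t ∈ Finset.Icc 1 v, ((k : ℝ) + t)⁻¹ ∧
      p ^ (-(v : ℤ)) * (∏ t ∈ Finset.Icc 1 v, ((k : ℝ) + t)⁻¹) ≤
        p ^ (-(v : ℤ)) * ((k : ℝ) + 1) ^ (-(v : ℤ)) := by
  obtain ⟨h0, h1⟩ := hp
  have hq : 0 < 1 - p := by linarith
  constructor
  · rw [aux_int μ k Γ hΓmeas hΓle (fun m => (∏ t ∈ Finset.Icc 1 v, ((m : ℝ) + t))⁻¹)]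
    refine le_trans (le_of_eq ?_) (aux_sum k v p h0 h1)
    apply Finset.sum_congr rfl
    intro m _
    rw [Measure.real, hΓ m, ENNReal.toReal_ofReal (by positivity)]
  · apply mul_le_mul_of_nonneg_left _ (by positivity)
    rw [zpow_neg, zpow_natCast, Finset.prod_inv_distrib]
    apply inv_anti₀ (by positivity)
    calc ((k : ℝ) + 1) ^ v = ∏ t ∈ Finset.Icc 1 v, ((k : ℝ) + 1) := by simp
      _ ≤ _ := by
        apply Finset.prod_le_prod
        · intros; positivity
        · intro t ht
          have : 1 ≤ t := (Finset.mem_Icc.1 ht).1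
          have : (1 : ℝ) ≤ t := by exact_mod_cast this
          linarith
end
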